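/- Let H and K be complex Hilbert spaces, let X be a TRO in B(K,H), and let D be a TRO-derivation on X. Then D is a strong operator limit of inner TRO-derivations: for every ε > 0 and every finite subset F ⊆ X, there exists an inner TRO-derivation D' of X such that ‖D(x) − D'(x)‖ < ε for all x ∈ F. -/

import Mathlib

open ContinuousLinearMap

section

open MeasureTheory Filter Topology FourierTransform

/-- A smooth function supported in the window of radius one around `a`, with a common bound `C` for
its derivatives of order at most two. -/
structure IsWindow (a C : ℝ) (g : ℝ → ℂ) : Prop where
  smooth : ContDiff ℝ (⊤ : ℕ∞) g
  supp : tsupport g ⊆ Set.Icc (a - 1) (a + 1)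
  bound : ∀ t, ‖g t‖ ≤ C ∧ ‖deriv g t‖ ≤ C ∧ ‖deriv (deriv g) t‖ ≤ C

theorem IsWindow.hasCompactSupport {a C : ℝ} {g : ℝ → ℂ} (hg : IsWindow a C g) :
    HasCompactSupport g :=
  isCompact_Icc.of_isClosed_subset (isClosed_tsupport g) hg.supp

theorem contDiff_deriv_of_smooth {g : ℝ → ℂ} (hg : ContDiff ℝ (⊤ : ℕ∞) g) :
    ContDiff ℝ (⊤ : ℕ∞) (deriv g) :=
  (contDiff_infty_iff_deriv.1 hg).2

theorem IsWindow.of_smooth {a : ℝ} {g : ℝ → ℂ} (hg : ContDiff ℝ (⊤ : ℕ∞) g)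
    (hs : tsupport g ⊆ Set.Icc (a - 1) (a + 1)) : ∃ C, IsWindow a C g := by
  have hc : HasCompactSupport g := isCompact_Icc.of_isClosed_subset (isClosed_tsupport g) hs
  have h1 := contDiff_deriv_of_smooth hg
  have h2 := contDiff_deriv_of_smooth h1
  obtain ⟨C0, hC0⟩ := hc.exists_bound_of_continuous hg.continuous
  obtain ⟨C1, hC1⟩ := hc.deriv.exists_bound_of_continuous h1.continuous
  obtain ⟨C2, hC2⟩ := hc.deriv.deriv.exists_bound_of_continuous h2.continuous
  refine ⟨max C0 (max C1 C2), hg, hs, fun t => ⟨(hC0 t).trans (le_max_left _ _), ?_, ?_⟩⟩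
  · exact (hC1 t).trans ((le_max_left _ _).trans (le_max_right _ _))
  · exact (hC2 t).trans ((le_max_right _ _).trans (le_max_right _ _))

theorem IsWindow.sub_mul {a C : ℝ} {g : ℝ → ℂ} (hg : IsWindow a C g) :
    IsWindow a (3 * C) (fun t => ((t : ℂ) - a) * g t) := by
  have hd0 : ∀ t, HasDerivAt g (deriv g t) t := fun t =>
    (hg.smooth.differentiable (by simp) t).hasDerivAt
  have hd1 : ∀ t, HasDerivAt (deriv g) (deriv (deriv g) t) t := fun t =>
    ((contDiff_deriv_of_smooth hg.smooth).differentiable (by simp) t).hasDerivAt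
  have hp : ∀ t : ℝ, HasDerivAt (fun s : ℝ => (s : ℂ) - a) 1 t := fun t =>
    (HasDerivAt.ofReal_comp (hasDerivAt_id t)).sub_const _ |>.congr_deriv (by simp)
  have e1 : deriv (fun t : ℝ => ((t : ℂ) - a) * g t)
      = fun t : ℝ => g t + ((t : ℂ) - a) * deriv g t := by
    ext t; rw [((hp t).fun_mul (hd0 t)).deriv, one_mul]
  have e2 : deriv (fun t : ℝ => g t + ((t : ℂ) - a) * deriv g t)
      = fun t : ℝ => deriv g t + (deriv g t + ((t : ℂ) - a) * deriv (deriv g) t) := by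
    ext t; rw [((hd0 t).fun_add ((hp t).fun_mul (hd1 t))).deriv, one_mul]
  have hbd : ∀ (u : ℝ → ℂ), tsupport u ⊆ Set.Icc (a - 1) (a + 1) → ∀ t : ℝ,
      ‖((t : ℂ) - a) * u t‖ ≤ ‖u t‖ := by
    intro u hu t
    by_cases ht : u t = 0
    · simp [ht]
    · have := hu (subset_tsupport u ht)
      have h1 : ‖(t : ℂ) - a‖ ≤ 1 := by
        rw [← Complex.ofReal_sub, Complex.norm_real, Real.norm_eq_abs, abs_le]
        constructor <;> linarith [this.1, this.2]
      rw [norm_mul]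
      exact mul_le_of_le_one_left (norm_nonneg _) h1
  have s1 : tsupport (deriv g) ⊆ Set.Icc (a - 1) (a + 1) :=
    (tsupport_deriv_subset).trans hg.supp
  have s2 : tsupport (deriv (deriv g)) ⊆ Set.Icc (a - 1) (a + 1) :=
    (tsupport_deriv_subset).trans s1
  refine ⟨?_, ?_, fun t => ?_⟩
  · exact (Complex.ofRealCLM.contDiff.sub contDiff_const).mul hg.smooth
  · exact (tsupport_mul_subset_right).trans hg.supp
  · obtain ⟨b0, b1, b2⟩ := hg.bound t
    have c0 := hbd g hg.supp t
    have c1 := hbd _ s1 t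
    have c2 := hbd _ s2 t
    have hC : 0 ≤ C := (norm_nonneg _).trans b0
    rw [e1, e2]
    refine ⟨by linarith, ?_, ?_⟩
    · exact (norm_add_le _ _).trans (by linarith)
    · have h3 := norm_add_le (deriv g t) (((t : ℂ) - a) * deriv (deriv g) t)
      exact (norm_add_le _ _).trans (by linarith)

theorem IsWindow.integrable_fourier {g : ℝ → ℂ} (hg : HasCompactSupport g)
    (hs : ContDiff ℝ (⊤ : ℕ∞) g) : Integrable (𝓕 g) := by
  have := (𝓕 (hg.toSchwartzMap hs)).integrable (μ := volume)
  exact this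

theorem IsWindow.norm_fourier_le {a C : ℝ} {g : ℝ → ℂ} (hg : IsWindow a C g) (t : ℝ) :
    ‖𝓕 g t‖ ≤ 4 * C * (1 + t ^ 2)⁻¹ := by
  have hd := contDiff_deriv_of_smooth hg.smooth
  have hdd := contDiff_deriv_of_smooth hd
  have hc := hg.hasCompactSupport
  have i0 : Integrable g := hg.smooth.continuous.integrable_of_hasCompactSupport hc
  have i1 : Integrable (deriv g) := hd.continuous.integrable_of_hasCompactSupport hc.deriv
  have i2 : Integrable (deriv (deriv g)) :=
    hdd.continuous.integrable_of_hasCompactSupport hc.deriv.deriv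
  have L1 : ∀ u : ℝ → ℂ, tsupport u ⊆ Set.Icc (a - 1) (a + 1) → (∀ s, ‖u s‖ ≤ C) →
      ‖𝓕 u t‖ ≤ 2 * C := by
    intro u hu hb
    have h1 : ‖𝓕 u t‖ ≤ ∫ s, ‖u s‖ := VectorFourier.norm_fourierIntegral_le_integral_norm _ _ _ _ _
    have h2 : ∫ s, ‖u s‖ = ∫ s in Set.Icc (a - 1) (a + 1), ‖u s‖ := by
      rw [setIntegral_eq_integral_of_forall_compl_eq_zero]
      intro s hs
      rw [image_eq_zero_of_notMem_tsupport (fun h => hs (hu h)), norm_zero]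
    have h3 : ‖∫ s in Set.Icc (a - 1) (a + 1), ‖u s‖‖ ≤ C * volume.real (Set.Icc (a - 1) (a + 1)) :=
      norm_setIntegral_le_of_norm_le_const (by simp) (fun s _ => by simpa using hb s)
    have h4 : volume.real (Set.Icc (a - 1) (a + 1)) = 2 := by
      rw [Real.volume_real_Icc_of_le (by linarith)]; ring
    rw [h4] at h3
    linarith [Real.le_norm_self (∫ s in Set.Icc (a - 1) (a + 1), ‖u s‖)]
  have s1 : tsupport (deriv g) ⊆ Set.Icc (a - 1) (a + 1) :=
    (tsupport_deriv_subset).trans hg.supp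
  have b0 := L1 g hg.supp (fun s => (hg.bound s).1)
  have b2 := L1 (deriv (deriv g)) ((tsupport_deriv_subset).trans s1) (fun s => (hg.bound s).2.2)
  rw [Real.fourier_deriv i1 (hd.differentiable (by simp)) i2,
    Real.fourier_deriv i0 (hg.smooth.differentiable (by simp)) i1] at b2
  have e : ‖(2 * Real.pi * Complex.I * t : ℂ)‖ = 2 * Real.pi * |t| := by
    simp [abs_of_pos Real.pi_pos]
  simp only [smul_eq_mul, norm_mul _ (_ * 𝓕 g t), norm_mul _ (𝓕 g t), e] at b2
  have hpi := Real.pi_gt_three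
  have hn := norm_nonneg (𝓕 g t)
  have h5 : t ^ 2 * ‖𝓕 g t‖ ≤ 2 * C := by
    refine le_trans ?_ b2
    have : 2 * Real.pi * |t| * (2 * Real.pi * |t| * ‖𝓕 g t‖)
      = (4 * Real.pi ^ 2) * (t ^ 2 * ‖𝓕 g t‖) := by rw [← sq_abs t]; ring
    rw [this]
    exact le_mul_of_one_le_left (by positivity) (by nlinarith)
  rw [← div_eq_mul_inv, le_div_iff₀ (by positivity)]
  nlinarith

section Flow

variable {X : Type*} [NormedAddCommGroup X] [NormedSpace ℂ X]

/-- The entire operator group generated by a bounded operator. -/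
noncomputable def flow (δ : X →L[ℂ] X) (z : ℂ) : X →L[ℂ] X := NormedSpace.exp (z • δ)

/-- The vectors whose `δ`-spectral subspace is contained in the disc of radius three around an
integer, expressed by growth of iterates. -/
def localizedVectors (δ : X →L[ℂ] X) : Set X :=
  {y | ∃ a : ℤ, ∃ C : ℝ, ∀ n : ℕ, ‖((δ - (a : ℂ) • 1) ^ n) y‖ ≤ C * 3 ^ n}

/-- The spectral average of `x` along the flow of `δ` with symbol `g`. -/
noncomputable def spectralMean (δ : X →L[ℂ] X) (g : ℝ → ℂ) (x : X) : X :=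
  ∫ t : ℝ, 𝓕 g t • flow δ (((2 * Real.pi * t : ℝ) : ℂ) * Complex.I) x

variable [CompleteSpace X] {δ : X →L[ℂ] X}

theorem hasDerivAt_flow (z : ℂ) (x : X) :
    HasDerivAt (fun z => flow δ z x) (δ (flow δ z x)) z := by
  have := (hasDerivAt_exp_smul_const' (𝕂 := ℂ) δ z)
  exact this.clm_apply (hasDerivAt_const z x) |>.congr_deriv (by simp [flow])

theorem continuous_flow (x : X) : Continuous fun z => flow δ z x :=
  continuous_iff_continuousAt.2 fun z => (hasDerivAt_flow z x).continuousAt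

theorem hasDerivAt_flow_line (x : X) (t : ℝ) :
    HasDerivAt (fun t : ℝ => flow δ (((2 * Real.pi * t : ℝ) : ℂ) * Complex.I) x)
      ((2 * Real.pi * Complex.I : ℂ) •
        δ (flow δ (((2 * Real.pi * t : ℝ) : ℂ) * Complex.I) x)) t := by
  have h1 : HasDerivAt (fun t : ℝ => ((2 * Real.pi * t : ℝ) : ℂ) * Complex.I)
      (2 * Real.pi * Complex.I) t := by
    have := ((hasDerivAt_id t).const_mul (2 * Real.pi)).ofReal_comp.mul_const Complex.I
    exact this.congr_deriv (by simp)
  exact (hasDerivAt_flow (δ := δ) _ x).scomp t h1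

variable (hδ : ∀ s : ℝ, ‖flow δ ((s : ℂ) * Complex.I)‖ ≤ 1)

include hδ in
theorem norm_flow_apply_le (s : ℝ) (x : X) : ‖flow δ ((s : ℂ) * Complex.I) x‖ ≤ ‖x‖ := by
  simpa using (flow δ ((s : ℂ) * Complex.I)).le_of_opNorm_le (hδ s) x

include hδ in
theorem integrable_smul_flow {u : ℝ → ℂ} (hu : Integrable u) (x : X) :
    Integrable fun t : ℝ => u t • flow δ (((2 * Real.pi * t : ℝ) : ℂ) * Complex.I) x := by
  have hc : Continuous fun t : ℝ => flow δ (((2 * Real.pi * t : ℝ) : ℂ) * Complex.I) x :=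
    (continuous_flow x).comp (by fun_prop)
  refine (hu.norm.mul_const ‖x‖).mono (hu.aestronglyMeasurable.smul hc.aestronglyMeasurable)
    (ae_of_all _ fun t => ?_)
  rw [norm_smul, norm_mul, norm_norm, norm_norm]
  gcongr
  exact norm_flow_apply_le hδ _ x

include hδ in
theorem apply_spectralMean {g : ℝ → ℂ} (hg : HasCompactSupport g)
    (hs : ContDiff ℝ (⊤ : ℕ∞) g) (x : X) :
    δ (spectralMean δ g x) = spectralMean δ (fun l => (l : ℂ) * g l) x := by
  have hc : HasCompactSupport fun l : ℝ => (l : ℂ) * g l := hg.mul_left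
  have hs' : ContDiff ℝ (⊤ : ℕ∞) fun l : ℝ => (l : ℂ) * g l :=
    Complex.ofRealCLM.contDiff.mul hs
  have i0 := IsWindow.integrable_fourier hg hs
  have i1 := IsWindow.integrable_fourier hc hs'
  have ig : Integrable g := hs.continuous.integrable_of_hasCompactSupport hg
  have ilg : Integrable fun l : ℝ => l • g l := by
    have := hs'.continuous.integrable_of_hasCompactSupport hc (μ := volume)
    exact this
  have hF : ∀ t, HasDerivAt (𝓕 g)
      ((-2 * Real.pi * Complex.I) * 𝓕 (fun l : ℝ => (l : ℂ) * g l) t) t := by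
    intro t
    refine (Real.hasDerivAt_fourier ig ilg t).congr_deriv ?_
    rw [Real.fourier_real_eq_integral_exp_smul, Real.fourier_real_eq_integral_exp_smul,
      ← integral_const_mul]
    congr 1; ext l; simp only [smul_eq_mul]; ring
  have key := integral_bilinear_hasDerivAt_right_eq_neg_left_of_integrable
    (L := (ContinuousLinearMap.lsmul ℝ ℂ : ℂ →L[ℝ] X →L[ℝ] X)) (u := 𝓕 g)
    (v := fun t : ℝ => flow δ (((2 * Real.pi * t : ℝ) : ℂ) * Complex.I) x)
    (fun t _ => hF t) (fun t _ => hasDerivAt_flow_line x t) ?_ ?_ ?_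
  · simp only [lsmul_apply] at key
    have e1 : ∀ t : ℝ, 𝓕 g t • ((2 * Real.pi * Complex.I : ℂ) •
        δ (flow δ (((2 * Real.pi * t : ℝ) : ℂ) * Complex.I) x))
        = (2 * Real.pi * Complex.I : ℂ) • δ (𝓕 g t •
          flow δ (((2 * Real.pi * t : ℝ) : ℂ) * Complex.I) x) := by
      intro t; rw [map_smul, smul_comm]
    have e2 : ∀ t : ℝ, ((-2 * Real.pi * Complex.I) * 𝓕 (fun l : ℝ => (l : ℂ) * g l) t) •
        flow δ (((2 * Real.pi * t : ℝ) : ℂ) * Complex.I) x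
        = (-(2 * Real.pi * Complex.I)) • (𝓕 (fun l : ℝ => (l : ℂ) * g l) t •
          flow δ (((2 * Real.pi * t : ℝ) : ℂ) * Complex.I) x) := by
      intro t; rw [smul_smul]; congr 1; ring
    simp only [e1, e2] at key
    rw [integral_smul, integral_smul, δ.integral_comp_comm (integrable_smul_flow hδ i0 x),
      neg_smul, neg_neg] at key
    exact smul_right_injective X (by simp [Real.pi_ne_zero]) key
  · have := ((δ.integrable_comp (integrable_smul_flow hδ i0 x)).smul
      (2 * Real.pi * Complex.I : ℂ))
    refine this.congr (ae_of_all _ fun t => ?_)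
    simp only [Pi.smul_apply, lsmul_apply, map_smul]
    exact smul_comm _ _ _
  · have := (integrable_smul_flow hδ i1 x).smul (-2 * Real.pi * Complex.I : ℂ)
    refine this.congr (ae_of_all _ fun t => ?_)
    simp only [Pi.smul_apply, lsmul_apply, smul_smul]
  · exact integrable_smul_flow hδ i0 x

include hδ in
theorem sub_apply_spectralMean {a C : ℝ} {g : ℝ → ℂ} (hg : IsWindow a C g) (x : X) :
    (δ - (a : ℂ) • 1) (spectralMean δ g x)
      = spectralMean δ (fun l => ((l : ℂ) - a) * g l) x := by
  have hc : HasCompactSupport fun l : ℝ => (l : ℂ) * g l := hg.hasCompactSupport.mul_left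
  have hs' : ContDiff ℝ (⊤ : ℕ∞) fun l : ℝ => (l : ℂ) * g l :=
    Complex.ofRealCLM.contDiff.mul hg.smooth
  have i0 := IsWindow.integrable_fourier hg.hasCompactSupport hg.smooth
  have i1 := IsWindow.integrable_fourier hc hs'
  have ie : ∀ {u : ℝ → ℂ}, HasCompactSupport u → Continuous u → ∀ t : ℝ, Integrable fun v : ℝ =>
      Complex.exp (((-2 * Real.pi * v * t : ℝ) : ℂ) * Complex.I) • u v := by
    intro u hu hcu t
    have h1 : Continuous fun v : ℝ =>
        Complex.exp (((-2 * Real.pi * v * t : ℝ) : ℂ) * Complex.I) := by fun_prop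
    exact (h1.smul hcu).integrable_of_hasCompactSupport hu.smul_left
  have e : 𝓕 (fun l : ℝ => ((l : ℂ) - a) * g l)
      = fun t => 𝓕 (fun l : ℝ => (l : ℂ) * g l) t - (a : ℂ) * 𝓕 g t := by
    ext t
    simp only [Real.fourier_real_eq_integral_exp_smul]
    rw [← integral_const_mul, ← integral_sub]
    · congr 1; ext l; simp only [smul_eq_mul]; ring
    · exact ie hc hs'.continuous t
    · exact (ie hg.hasCompactSupport hg.smooth.continuous t).const_mul _
  change δ (spectralMean δ g x) - (a : ℂ) • spectralMean δ g x = _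
  rw [apply_spectralMean hδ hg.hasCompactSupport hg.smooth]
  simp only [spectralMean, e, sub_smul, mul_smul]
  rw [← integral_smul]
  exact (integral_sub (integrable_smul_flow hδ i1 x)
    ((integrable_smul_flow hδ i0 x).smul (a : ℂ))).symm

include hδ in
theorem norm_spectralMean_le {a C : ℝ} {g : ℝ → ℂ} (hg : IsWindow a C g) (x : X) :
    ‖spectralMean δ g x‖ ≤ 4 * C * Real.pi * ‖x‖ := by
  have : 4 * C * Real.pi * ‖x‖ = ∫ t : ℝ, 4 * C * (1 + t ^ 2)⁻¹ * ‖x‖ := by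
    rw [integral_mul_const, integral_const_mul, integral_univ_inv_one_add_sq]
  rw [this]
  refine norm_integral_le_of_norm_le
    ((integrable_inv_one_add_sq.const_mul _).mul_const _) (ae_of_all _ fun t => ?_)
  rw [norm_smul]
  exact mul_le_mul (hg.norm_fourier_le t) (norm_flow_apply_le hδ _ x) (norm_nonneg _)
    ((norm_nonneg _).trans (hg.norm_fourier_le t))

include hδ in
theorem norm_pow_spectralMean_le (n : ℕ) {a C : ℝ} {g : ℝ → ℂ} (hg : IsWindow a C g) (x : X) :
    ‖((δ - (a : ℂ) • 1) ^ n) (spectralMean δ g x)‖ ≤ 4 * C * Real.pi * ‖x‖ * 3 ^ n := by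
  induction n generalizing C g with
  | zero => simpa using norm_spectralMean_le hδ hg x
  | succ n ih =>
    rw [pow_succ]
    change ‖((δ - (a : ℂ) • 1) ^ n) ((δ - (a : ℂ) • 1) (spectralMean δ g x))‖ ≤ _
    rw [sub_apply_spectralMean hδ hg]
    exact (ih hg.sub_mul).trans (le_of_eq (by ring))

include hδ in
theorem spectralMean_mem_localizedVectors {a : ℤ} {g : ℝ → ℂ} (hg : ContDiff ℝ (⊤ : ℕ∞) g)
    (hs : tsupport g ⊆ Set.Icc ((a : ℝ) - 1) (a + 1)) (x : X) :
    spectralMean δ g x ∈ localizedVectors δ := by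
  obtain ⟨C, hC⟩ := IsWindow.of_smooth hg hs
  exact ⟨a, _, fun n => by simpa using norm_pow_spectralMean_le hδ n hC x⟩

end Flow

section Density

variable {X : Type*} [NormedAddCommGroup X] [NormedSpace ℂ X]
variable [CompleteSpace X] {δ : X →L[ℂ] X}
variable (hδ : ∀ s : ℝ, ‖flow δ ((s : ℂ) * Complex.I)‖ ≤ 1)

include hδ in
theorem spectralMean_add {g h : ℝ → ℂ} (hg : HasCompactSupport g)
    (hgs : ContDiff ℝ (⊤ : ℕ∞) g) (hh : HasCompactSupport h) (hhs : ContDiff ℝ (⊤ : ℕ∞) h) (x : X) :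
    spectralMean δ (fun l => g l + h l) x = spectralMean δ g x + spectralMean δ h x := by
  have ie : ∀ {u : ℝ → ℂ}, HasCompactSupport u → Continuous u → ∀ t : ℝ, Integrable fun v : ℝ =>
      Complex.exp (((-2 * Real.pi * v * t : ℝ) : ℂ) * Complex.I) • u v := by
    intro u hu hcu t
    have h1 : Continuous fun v : ℝ =>
        Complex.exp (((-2 * Real.pi * v * t : ℝ) : ℂ) * Complex.I) := by fun_prop
    exact (h1.smul hcu).integrable_of_hasCompactSupport hu.smul_left
  have e : 𝓕 (fun l : ℝ => g l + h l) = fun t => 𝓕 g t + 𝓕 h t := by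
    ext t
    simp only [Real.fourier_real_eq_integral_exp_smul]
    rw [← integral_add (ie hg hgs.continuous t) (ie hh hhs.continuous t)]
    simp only [smul_add]
  simp only [spectralMean, e, add_smul]
  exact integral_add (integrable_smul_flow hδ (IsWindow.integrable_fourier hg hgs) x)
    (integrable_smul_flow hδ (IsWindow.integrable_fourier hh hhs) x)

include hδ in
theorem spectralMean_mem_span (N : ℕ) (a : ℤ) {g : ℝ → ℂ} (hg : ContDiff ℝ (⊤ : ℕ∞) g)
    (hs : tsupport g ⊆ Set.Icc ((a : ℝ) - 1) (a + 1 + N)) (x : X) :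
    spectralMean δ g x ∈ Submodule.span ℂ (localizedVectors δ) := by
  induction N generalizing a g with
  | zero =>
    exact Submodule.subset_span (spectralMean_mem_localizedVectors hδ hg (by simpa using hs) x)
  | succ N ih =>
    let S : ℝ → ℂ := fun t => (Real.smoothTransition (t - a) : ℂ)
    have hS : ContDiff ℝ (⊤ : ℕ∞) S := Complex.ofRealCLM.contDiff.comp
      (Real.smoothTransition.contDiff.comp (contDiff_id.sub contDiff_const))
    have d1 : ContDiff ℝ (⊤ : ℕ∞) fun t => (1 - S t) * g t := (contDiff_const.sub hS).mul hg
    have d2 : ContDiff ℝ (⊤ : ℕ∞) fun t => S t * g t := hS.mul hg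
    have s1 : tsupport (fun t => (1 - S t) * g t) ⊆ Set.Icc ((a : ℝ) - 1) (a + 1) := by
      intro t ht
      refine ⟨(hs (tsupport_mul_subset_right ht)).1, ?_⟩
      have : tsupport (fun t => (1 - S t)) ⊆ Set.Iic ((a : ℝ) + 1) := by
        refine closure_minimal (fun t ht => ?_) isClosed_Iic
        by_contra hlt
        rw [Set.mem_Iic, not_le] at hlt
        exact ht (by simp [S, Real.smoothTransition.one_of_one_le (show 1 ≤ t - a by linarith)])
      exact this (tsupport_mul_subset_left ht)
    have s2 : tsupport (fun t => S t * g t)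
        ⊆ Set.Icc (((a + 1 : ℤ) : ℝ) - 1) ((a + 1 : ℤ) + 1 + N) := by
      intro t ht
      have h2 := (hs (tsupport_mul_subset_right ht)).2
      have : tsupport S ⊆ Set.Ici (a : ℝ) := by
        refine closure_minimal (fun t ht => ?_) isClosed_Ici
        by_contra hlt
        rw [Set.mem_Ici, not_le] at hlt
        exact ht (by simp [S, Real.smoothTransition.zero_of_nonpos (show t - a ≤ 0 by linarith)])
      have h1 : (a : ℝ) ≤ t := this (tsupport_mul_subset_left ht)
      push_cast at h2 ⊢
      constructor <;> linarith
    have e : g = fun t => (1 - S t) * g t + S t * g t := by ext t; ring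
    rw [e, spectralMean_add hδ (isCompact_Icc.of_isClosed_subset (isClosed_tsupport _) s1) d1
      (isCompact_Icc.of_isClosed_subset (isClosed_tsupport _) s2) d2]
    exact Submodule.add_mem _
      (Submodule.subset_span (spectralMean_mem_localizedVectors hδ d1 s1 x)) (ih (a + 1) d2 s2)

include hδ in
theorem spectralMean_comp_div {g : ℝ → ℂ} {r : ℝ} (hr : 0 < r) (x : X) :
    spectralMean δ (fun l => g (l / r)) x =
      ∫ t : ℝ, 𝓕 g t • flow δ (((2 * Real.pi * (t / r) : ℝ) : ℂ) * Complex.I) x := by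
  have e : ∀ t, 𝓕 (fun l : ℝ => g (l / r)) t = (r : ℂ) * 𝓕 g (r * t) := by
    intro t
    simp only [Real.fourier_real_eq_integral_exp_smul]
    have := Measure.integral_comp_div (fun v : ℝ =>
      Complex.exp (((-2 * Real.pi * v * (r * t) : ℝ) : ℂ) * Complex.I) • g v) r
    rw [abs_of_pos hr, Complex.real_smul] at this
    rw [← this]
    congr 1; ext v
    rw [show -2 * Real.pi * v * t = -2 * Real.pi * (v / r) * (r * t) by field_simp]
  have h := Measure.integral_comp_mul_left (fun t : ℝ =>
    𝓕 g t • flow δ (((2 * Real.pi * (t / r) : ℝ) : ℂ) * Complex.I) x) r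
  have h2 : ∫ t : ℝ, 𝓕 g t • flow δ (((2 * Real.pi * (t / r) : ℝ) : ℂ) * Complex.I) x
    = r • (|r⁻¹| • ∫ t : ℝ, 𝓕 g t • flow δ (((2 * Real.pi * (t / r) : ℝ) : ℂ) * Complex.I) x) := by
    rw [smul_smul, abs_of_pos (inv_pos.2 hr), mul_inv_cancel₀ hr.ne', one_smul]
  rw [h2, ← h, ← integral_smul]
  simp only [spectralMean, e]
  congr 1; ext t
  rw [mul_smul, mul_div_cancel_left₀ _ hr.ne', Complex.coe_smul]

include hδ in
theorem mem_closure_span_localizedVectors (x : X) :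
    x ∈ closure (Submodule.span ℂ (localizedVectors δ) : Set X) := by
  let b : ContDiffBump (0 : ℝ) := ⟨1, 2, one_pos, by norm_num⟩
  let φ : ℝ → ℂ := fun t => (b t : ℂ)
  have hφs : ContDiff ℝ (⊤ : ℕ∞) φ := Complex.ofRealCLM.contDiff.comp b.contDiff
  have hb : tsupport b = Metric.closedBall 0 2 := b.tsupport_eq
  have hφt : ∀ t, φ t ≠ 0 → |t| ≤ 2 := by
    intro t ht
    have : b t ≠ 0 := fun h => ht (by simp [φ, h])
    have := subset_tsupport _ this
    rw [hb] at this
    simpa using this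
  have hφc : HasCompactSupport φ :=
    HasCompactSupport.intro (isCompact_closedBall (0 : ℝ) 2) fun t ht => by
      by_contra h
      exact ht (by simpa using hφt t h)
  have hF := IsWindow.integrable_fourier hφc hφs
  have hone : ∫ t, 𝓕 φ t = 1 := by
    have h := Integrable.fourierInv_fourier_eq
      (hφs.continuous.integrable_of_hasCompactSupport hφc) hF (v := 0) hφs.continuous.continuousAt
    rw [Real.fourierInv_eq'] at h
    simp only [inner_zero_right, mul_zero, Complex.ofReal_zero, zero_mul, Complex.exp_zero,
      one_smul] at h
    rw [h]
    have : b 0 = 1 := b.one_of_mem_closedBall (by simp [b])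
    simp [φ, this]
  have hlim : Tendsto (fun n : ℕ => spectralMean δ (fun l => φ (l / ((n : ℝ) + 1))) x) atTop
      (𝓝 x) := by
    have hx : x = ∫ t, 𝓕 φ t • x := by rw [integral_smul_const, hone, one_smul]
    have key : Tendsto (fun n : ℕ => ∫ t : ℝ, 𝓕 φ t •
        flow δ (((2 * Real.pi * (t / ((n : ℝ) + 1)) : ℝ) : ℂ) * Complex.I) x) atTop
        (𝓝 (∫ t, 𝓕 φ t • x)) := by
      refine tendsto_integral_of_dominated_convergence (fun t => ‖𝓕 φ t‖ * ‖x‖) (fun n => ?_)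
        (hF.norm.mul_const _) (fun n => ae_of_all _ fun t => ?_) (ae_of_all _ fun t => ?_)
      · refine hF.aestronglyMeasurable.smul (Continuous.aestronglyMeasurable ?_)
        exact (continuous_flow x).comp (by fun_prop)
      · rw [norm_smul]
        gcongr
        exact norm_flow_apply_le hδ _ x
      · refine Tendsto.const_smul ?_ _
        have h0 : flow δ (((2 * Real.pi * 0 : ℝ) : ℂ) * Complex.I) x = x := by
          simp [flow, NormedSpace.exp_zero]
        nth_rewrite 2 [← h0]
        have hc : Continuous fun s : ℝ => flow δ (((2 * Real.pi * s : ℝ) : ℂ) * Complex.I) x :=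
          (continuous_flow x).comp (by fun_prop)
        exact (hc.tendsto 0).comp (tendsto_const_div_atTop_nhds_zero_nat t |>.comp
          (tendsto_add_atTop_nat 1) |>.congr fun n => by simp)
    rw [← hx] at key
    exact key.congr fun n => (spectralMean_comp_div hδ (by positivity) x).symm
  refine mem_closure_of_tendsto hlim (Eventually.of_forall fun n => ?_)
  have hn : (0 : ℝ) < n + 1 := by positivity
  refine spectralMean_mem_span hδ (4 * (n + 1)) (-2 * (n + 1)) ?_ ?_ x
  · exact hφs.comp (contDiff_id.div_const _)
  · refine closure_minimal (fun t ht => ?_) isClosed_Icc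
    have := hφt _ ht
    rw [abs_div, abs_of_pos hn, div_le_iff₀ hn, abs_le] at this
    push_cast
    constructor <;> linarith [this.1, this.2]

end Density

section FlowGrowth

variable {X : Type*} [NormedAddCommGroup X] [NormedSpace ℂ X] [CompleteSpace X]

theorem flow_zero (δ : X →L[ℂ] X) : flow δ 0 = 1 := by simp [flow, NormedSpace.exp_zero]

theorem flow_add (δ : X →L[ℂ] X) (z w : ℂ) (x : X) :
    flow δ (z + w) x = flow δ z (flow δ w x) := by
  letI : NormedAlgebra ℚ (X →L[ℂ] X) := NormedAlgebra.restrictScalars ℚ ℂ _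
  have h : flow δ (z + w) = flow δ z * flow δ w := by
    rw [flow, add_smul]
    exact NormedSpace.exp_add_of_commute (((Commute.refl δ).smul_left z).smul_right w)
  rw [h]; rfl

theorem norm_exp_apply_le_of_pow {T : X →L[ℂ] X} {y : X} {C c : ℝ}
    (h : ∀ n : ℕ, ‖(T ^ n) y‖ ≤ C * c ^ n) (z : ℂ) :
    ‖NormedSpace.exp (z • T) y‖ ≤ C * Real.exp (c * ‖z‖) := by
  have h1 := (NormedSpace.exp_series_hasSum_exp' (𝕂 := ℂ) (z • T))
  have h2 := (ContinuousLinearMap.apply ℂ X y).hasSum h1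
  have h3 : HasSum (fun n : ℕ => C * ((c * ‖z‖) ^ n / (n.factorial : ℝ)))
      (C * Real.exp (c * ‖z‖)) := by
    refine HasSum.mul_left C ?_
    rw [Real.exp_eq_exp_ℝ]
    exact NormedSpace.expSeries_div_hasSum_exp _
  have h4 : ‖NormedSpace.exp (z • T) y‖ ≤ ∑' n : ℕ, C * ((c * ‖z‖) ^ n / (n.factorial : ℝ)) := by
    rw [show NormedSpace.exp (z • T) y = _ from h2.tsum_eq.symm]
    refine tsum_of_norm_bounded h3.summable.hasSum fun n => ?_
    simp only [ContinuousLinearMap.apply_apply]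
    change ‖(n.factorial : ℂ)⁻¹ • ((z • T) ^ n) y‖ ≤ _
    rw [smul_pow]
    change ‖(n.factorial : ℂ)⁻¹ • z ^ n • (T ^ n) y‖ ≤ _
    rw [norm_smul, norm_smul, norm_inv, norm_pow, Complex.norm_natCast, mul_pow]
    calc _ ≤ (n.factorial : ℝ)⁻¹ * (‖z‖ ^ n * (C * c ^ n)) := by gcongr; exact h n
      _ = _ := by ring
  exact h4.trans h3.tsum_eq.le

theorem norm_flow_apply_le_exp (δ : X →L[ℂ] X) (z : ℂ) (x : X) :
    ‖flow δ z x‖ ≤ ‖x‖ * Real.exp (‖δ‖ * ‖z‖) := by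
  refine norm_exp_apply_le_of_pow (fun n => ?_) z
  rw [mul_comm]
  refine ((δ ^ n).le_opNorm x).trans ?_
  gcongr
  rcases Nat.eq_zero_or_pos n with rfl | hn
  · rw [pow_zero, pow_zero]; exact ContinuousLinearMap.norm_id_le
  · exact norm_pow_le' δ hn

theorem norm_flow_le_of_mem_localizedVectors {δ : X →L[ℂ] X} {y : X}
    (hy : y ∈ localizedVectors δ) :
    ∃ a : ℤ, ∃ C : ℝ, ∀ r : ℝ, ‖flow δ r y‖ ≤ C * Real.exp (3 * |r| + a * r) := by
  letI : NormedAlgebra ℚ (X →L[ℂ] X) := NormedAlgebra.restrictScalars ℚ ℂ _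
  obtain ⟨a, C, h⟩ := hy
  refine ⟨a, C, fun r => ?_⟩
  have e : flow δ r = Complex.exp (r * a) • NormedSpace.exp ((r : ℂ) • (δ - (a : ℂ) • 1)) := by
    have h1 : (r : ℂ) • δ = algebraMap ℂ (X →L[ℂ] X) (r * a) + (r : ℂ) • (δ - (a : ℂ) • 1) := by
      rw [Algebra.algebraMap_eq_smul_one, smul_sub, smul_smul]; abel
    rw [flow, h1, NormedSpace.exp_add_of_commute (Algebra.commutes _ _),
      ← NormedSpace.algebraMap_exp_comm, ← Complex.exp_eq_exp_ℂ, ← Algebra.smul_def]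
  rw [e]
  change ‖Complex.exp (r * a) • NormedSpace.exp ((r : ℂ) • (δ - (a : ℂ) • 1)) y‖ ≤ _
  have h2 := norm_exp_apply_le_of_pow h (r : ℂ)
  rw [Complex.norm_real, Real.norm_eq_abs] at h2
  rw [norm_smul, Complex.norm_exp, Real.exp_add]
  have : ((r : ℂ) * a).re = a * r := by simp [mul_comm]
  rw [this]
  calc _ ≤ Real.exp (a * r) * (C * Real.exp (3 * |r|)) := by gcongr
    _ = _ := by ring

end FlowGrowth

section Ternary

variable {X : Type*} [NormedAddCommGroup X] [NormedSpace ℂ X] [CompleteSpace X]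
  {B : Type*} [CStarAlgebra B]

theorem norm_mul_star_mul_self (a : B) : ‖a * star a * a‖ = ‖a‖ ^ 3 := by
  refine le_antisymm ?_ ?_
  · calc ‖a * star a * a‖ ≤ ‖a‖ * ‖star a‖ * ‖a‖ :=
        (norm_mul_le _ _).trans (by gcongr; exact norm_mul_le _ _)
      _ = ‖a‖ ^ 3 := by rw [norm_star]; ring
  · rcases eq_or_ne a 0 with rfl | ha
    · simp
    have h1 : ‖star a * (a * star a * a)‖ = ‖a‖ ^ 4 := by
      have : star a * (a * star a * a) = star (star a * a) * (star a * a) := by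
        simp [mul_assoc]
      rw [this, CStarRing.norm_star_mul_self, CStarRing.norm_star_mul_self]; ring
    have h2 := norm_mul_le (star a) (a * star a * a)
    rw [h1, norm_star] at h2
    have h3 : 0 < ‖a‖ := norm_pos_iff.2 ha
    nlinarith

theorem hasDerivAt_of_linearIsometry (ι : X →ₗᵢ[ℂ] B) {f : ℝ → X} {f' : X} {r : ℝ}
    (h : HasDerivAt (fun s => ι (f s)) (ι f') r) : HasDerivAt f f' r := by
  rw [hasDerivAt_iff_isLittleO] at h ⊢
  refine (Asymptotics.isLittleO_norm_left.1 ?_)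
  refine (Asymptotics.isLittleO_norm_left.2 h).congr_left fun s => ?_
  have : (s - r) • ι f' = ι ((s - r) • f') := by
    rw [← Complex.coe_smul, ← Complex.coe_smul, map_smul]
  rw [this, ← map_sub, ← map_sub, ι.norm_map]

variable {ι : X →ₗᵢ[ℂ] B} {t : X → X → X → X} {δ : X →L[ℂ] X}
  (ht : ∀ x y z, ι (t x y z) = ι x * star (ι y) * ι z)
  (hδ : ∀ x y z, ι (δ (t x y z)) =
    ι (δ x) * star (ι y) * ι z - ι x * star (ι (δ y)) * ι z + ι x * star (ι y) * ι (δ z))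

include ht hδ in
theorem map_flow_ternary (ω : ℂ) (r : ℝ) (x y w : X) :
    ι (flow δ (r * ω) (t x y w)) = ι (flow δ (r * ω) x) *
      star (ι (flow δ (-(r * star ω)) y)) * ι (flow δ (r * ω) w) := by
  have hU : ∀ (v : ℂ) (x : X) (r : ℝ), HasDerivAt (fun r : ℝ => flow δ (r * v) x)
      (v • δ (flow δ (r * v) x)) r := by
    intro v x r
    have h1 : HasDerivAt (fun t : ℝ => (t : ℂ) * v) v r :=
      ((hasDerivAt_id r).ofReal_comp.mul_const v).congr_deriv (by simp)
    exact (hasDerivAt_flow (δ := δ) _ x).scomp r h1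
  let ιL : X →L[ℝ] B := (ι.toContinuousLinearMap).restrictScalars ℝ
  have hι : ∀ (v : ℂ) (x : X) (r : ℝ), HasDerivAt (fun r : ℝ => ι (flow δ (r * v) x))
      (v • ι (δ (flow δ (r * v) x))) r := by
    intro v x r
    have := (ιL.hasFDerivAt).comp_hasDerivAt r (hU v x r)
    exact this.congr_deriv (by simp [ιL])
  let F : ℝ → X := fun r => t (flow δ (r * ω) x) (flow δ (r * (-star ω)) y) (flow δ (r * ω) w)
  have hF : ∀ r, HasDerivAt F (ω • δ (F r)) r := by
    intro r
    refine hasDerivAt_of_linearIsometry ι ?_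
    simp only [F, ht, map_smul, hδ]
    refine (((hι ω x r).fun_mul (hι (-star ω) y r).star).fun_mul (hι ω w r)).congr_deriv ?_
    simp only [star_smul, star_neg, star_star, smul_add, smul_sub, smul_mul_assoc, mul_smul_comm,
      neg_smul, mul_neg, neg_mul, add_mul]
    abel
  have hG : ∀ r, HasDerivAt (fun r : ℝ => flow δ (r * (-ω)) (F r)) 0 r := by
    intro r
    have hop : HasDerivAt (fun r : ℝ => flow δ (r * (-ω))) ((-ω) • (flow δ (r * (-ω)) * δ)) r := by
      have h1 : HasDerivAt (fun t : ℝ => (t : ℂ) * (-ω)) (-ω) r :=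
        ((hasDerivAt_id r).ofReal_comp.mul_const (-ω)).congr_deriv (by simp)
      exact (hasDerivAt_exp_smul_const (𝕂 := ℂ) δ _).scomp r h1
    have hop' : HasDerivAt (fun r : ℝ => (flow δ (r * (-ω))).restrictScalars ℝ)
        (((-ω) • (flow δ (r * (-ω)) * δ)).restrictScalars ℝ) r :=
      (ContinuousLinearMap.restrictScalarsL ℂ X X ℝ ℝ).hasFDerivAt.comp_hasDerivAt r hop
    refine (hop'.clm_apply (hF r)).congr_deriv ?_
    simp only [coe_restrictScalars', map_smul]
    change (-ω) • flow δ (r * (-ω)) (δ (F r)) + _ = 0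
    rw [neg_smul, neg_add_cancel]
  have hc := is_const_of_deriv_eq_zero (fun r => (hG r).differentiableAt)
    (fun r => (hG r).deriv) r 0
  simp only [F, Complex.ofReal_zero, zero_mul, flow_zero] at hc
  change flow δ (r * (-ω)) (F r) = t x y w at hc
  rw [← hc, ← flow_add, show (r : ℂ) * ω + r * (-ω) = 0 by ring, flow_zero]
  change ι (F r) = _
  simp only [F, ht, mul_neg]

include ht hδ in
theorem norm_flow_mul_I_le (s : ℝ) : ‖flow δ ((s : ℂ) * Complex.I)‖ ≤ 1 := by
  set T := flow δ ((s : ℂ) * Complex.I) with hT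
  have h : ∀ x, ‖T x‖ ^ 3 ≤ ‖T‖ * ‖x‖ ^ 3 := by
    intro x
    have h1 := map_flow_ternary ht hδ Complex.I s x x x
    rw [show -((s : ℂ) * star Complex.I) = s * Complex.I by simp, ← hT] at h1
    calc ‖T x‖ ^ 3 = ‖T (t x x x)‖ := by
          rw [← ι.norm_map (T (t x x x)), h1, norm_mul_star_mul_self, ι.norm_map]
      _ ≤ ‖T‖ * ‖t x x x‖ := T.le_opNorm _
      _ = ‖T‖ * ‖x‖ ^ 3 := by rw [← ι.norm_map (t x x x), ht, norm_mul_star_mul_self, ι.norm_map]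
  set c := ‖T‖ ^ (1 / 3 : ℝ) with hc
  have hc0 : 0 ≤ c := by positivity
  have hc3 : c ^ 3 = ‖T‖ := by
    rw [hc, ← Real.rpow_natCast, ← Real.rpow_mul (norm_nonneg _)]; norm_num
  have hle : ‖T‖ ≤ c := by
    refine T.opNorm_le_bound hc0 fun x => ?_
    refine le_of_pow_le_pow_left₀ (n := 3) (by norm_num) (by positivity) ?_
    rw [mul_pow, hc3]; exact h x
  by_contra hlt
  rw [not_le] at hlt
  have : 1 < c := by
    by_contra hh
    rw [not_lt] at hh
    have := pow_le_one₀ (n := 3) hc0 hh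
    linarith
  nlinarith [mul_pos (sub_pos.2 this) (sub_pos.2 this)]

end Ternary

section ExponentialType

variable {A : Type*} [NormedAddCommGroup A] [NormedSpace ℂ A]

theorem norm_le_exp_re_of_bound_axes {F : ℂ → A} (hF : Differentiable ℂ F) {K c b C : ℝ}
    (hgrow : ∀ z, ‖F z‖ ≤ K * Real.exp (c * ‖z‖)) (him : ∀ s : ℝ, ‖F (s * Complex.I)‖ ≤ b)
    (hre : ∀ r : ℝ, 0 ≤ r → ‖F r‖ ≤ C * Real.exp (6 * r)) {z : ℂ} (hz : 0 ≤ z.re) :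
    ‖F z‖ ≤ b * Real.exp (6 * z.re) := by
  have hn : ∀ z : ℂ, ‖Complex.exp (-6 * z)‖ = Real.exp (-(6 * z.re)) := by
    intro z; rw [Complex.norm_exp]; simp
  have key := PhragmenLindelof.right_half_plane_of_bounded_on_real (C := b)
    (f := fun z => Complex.exp (-6 * z) • F z) (z := z) ?_ ?_ ?_ ?_ hz
  · simp only [norm_smul, hn, Real.exp_neg] at key
    rwa [inv_mul_le_iff₀ (Real.exp_pos _), mul_comm] at key
  · exact Differentiable.diffContOnCl (by fun_prop)
  · refine ⟨1, by norm_num, 6 + c, Asymptotics.IsBigO.of_bound K (Eventually.of_forall fun z => ?_)⟩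
    rw [norm_smul, hn, Real.norm_eq_abs, Real.abs_exp, Real.rpow_one]
    have h1 : Real.exp (-(6 * z.re)) ≤ Real.exp (6 * ‖z‖) := by
      gcongr; linarith [neg_abs_le z.re, Complex.abs_re_le_norm z]
    calc _ ≤ Real.exp (6 * ‖z‖) * (K * Real.exp (c * ‖z‖)) :=
          mul_le_mul h1 (hgrow z) (norm_nonneg _) (Real.exp_pos _).le
      _ = _ := by rw [add_mul, Real.exp_add]; ring
  · refine ⟨C, ?_⟩
    rw [eventually_map]
    filter_upwards [eventually_ge_atTop (0 : ℝ)] with r hr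
    rw [norm_smul, hn, Complex.ofReal_re, Real.exp_neg, inv_mul_le_iff₀ (Real.exp_pos _), mul_comm]
    exact hre r hr
  · intro s
    rw [norm_smul, hn]
    simpa using him s

theorem norm_deriv_zero_le_of_bound_axes {F : ℂ → A} (hF : Differentiable ℂ F) {K c b C : ℝ}
    (hgrow : ∀ z, ‖F z‖ ≤ K * Real.exp (c * ‖z‖)) (him : ∀ s : ℝ, ‖F (s * Complex.I)‖ ≤ b)
    (hre : ∀ r : ℝ, ‖F r‖ ≤ C * Real.exp (6 * |r|)) :
    ‖deriv F 0‖ ≤ Real.exp 6 * b := by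
  have hb : 0 ≤ b := (norm_nonneg _).trans (him 0)
  have h1 : ∀ z : ℂ, 0 ≤ z.re → ‖F z‖ ≤ b * Real.exp (6 * z.re) := fun z hz =>
    norm_le_exp_re_of_bound_axes hF hgrow him
      (fun r hr => by simpa [abs_of_nonneg hr] using hre r) hz
  have h2 : ∀ z : ℂ, 0 ≤ z.re → ‖F (-z)‖ ≤ b * Real.exp (6 * z.re) := fun z hz =>
    norm_le_exp_re_of_bound_axes (F := fun z => F (-z)) (by fun_prop)
      (fun z => by simpa using hgrow (-z)) (fun s => by simpa using him (-s))
      (fun r hr => by simpa [abs_of_nonneg hr] using hre (-r)) hz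
  have h3 := Complex.norm_deriv_le_of_forall_mem_sphere_norm_le (f := F) (c := 0) (R := 1)
    (C := Real.exp 6 * b) one_pos hF.diffContOnCl fun z hz => ?_
  · simpa using h3
  · have hz1 : ‖z‖ = 1 := by simpa using hz
    have hre1 := Complex.abs_re_le_norm z
    rw [hz1, abs_le] at hre1
    rcases le_total 0 z.re with h | h
    · refine (h1 z h).trans ?_
      rw [mul_comm]; gcongr; linarith
    · have := h2 (-z) (by simpa using h)
      rw [neg_neg] at this
      refine this.trans ?_
      rw [mul_comm]; gcongr; rw [Complex.neg_re]; linarith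

end ExponentialType

section Weights

variable {A : Type*} [CStarAlgebra A]

/-- The exponential of `z` times the grading operator of an orthogonal family of projections. -/
noncomputable def weight (e : ℕ → A) (N : ℕ) (z : ℂ) : A :=
  ∑ i ∈ Finset.range N, Complex.exp (z * i) • e i

theorem hasDerivAt_weight (e : ℕ → A) (N : ℕ) :
    HasDerivAt (weight e N) (∑ i ∈ Finset.range N, (i : ℂ) • e i) 0 := by
  refine HasDerivAt.fun_sum fun i _ => ?_
  have h : HasDerivAt (fun z : ℂ => Complex.exp (z * i)) (i : ℂ) 0 :=
    (((hasDerivAt_id (0 : ℂ)).mul_const (i : ℂ)).cexp).congr_deriv (by simp)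
  exact h.smul_const (e i)

theorem differentiable_weight (e : ℕ → A) (N : ℕ) : Differentiable ℂ (weight e N) := by
  unfold weight; fun_prop

theorem weight_zero (e : ℕ → A) (N : ℕ) : weight e N 0 = ∑ i ∈ Finset.range N, e i := by
  simp [weight]

theorem norm_weight_le {e : ℕ → A} (he : ∀ i, ‖e i‖ ≤ 1) (N : ℕ) (z : ℂ) :
    ‖weight e N z‖ ≤ N * Real.exp (N * ‖z‖) := by
  refine (norm_sum_le _ _).trans ((Finset.sum_le_card_nsmul _ _ (Real.exp (N * ‖z‖)) ?_).trans
    (by simp))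
  intro i hi
  have hiN : (i : ℝ) ≤ N := by exact_mod_cast (Finset.mem_range.1 hi).le
  rw [norm_smul, Complex.norm_exp]
  refine (mul_le_of_le_one_right (Real.exp_pos _).le (he i)).trans ?_
  gcongr
  refine (Complex.re_le_norm _).trans ?_
  rw [norm_mul, mul_comm, Complex.norm_natCast]
  gcongr

variable {e : ℕ → A} (he : ∀ i, IsStarProjection (e i)) (heo : ∀ i j, i ≠ j → e i * e j = 0)

include he heo in
theorem isStarProjection_sum_range (N : ℕ) :
    IsStarProjection (∑ i ∈ Finset.range N, e i) := by
  refine ⟨?_, ?_⟩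
  · rw [IsIdempotentElem, Finset.sum_mul_sum]
    refine Finset.sum_congr rfl fun i hi => ?_
    rw [Finset.sum_eq_single i (fun j _ hj => heo i j hj.symm) (fun h => absurd hi h)]
    exact (he i).isIdempotentElem
  · exact isSelfAdjoint_sum _ fun i _ => (he i).isSelfAdjoint

include he heo in
theorem norm_weight_mul_I_le (N : ℕ) (s : ℝ) : ‖weight e N (s * Complex.I)‖ ≤ 1 := by
  have h : star (weight e N (s * Complex.I)) * weight e N (s * Complex.I)
      = ∑ i ∈ Finset.range N, e i := by
    simp only [weight, star_sum, star_smul, (he _).isSelfAdjoint.star_eq]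
    rw [Finset.sum_mul_sum]
    refine Finset.sum_congr rfl fun i hi => ?_
    rw [Finset.sum_eq_single i (fun j _ hj => ?_) (fun h => absurd hi h)]
    · rw [smul_mul_smul_comm, (he i).isIdempotentElem.eq]
      have : star (Complex.exp (s * Complex.I * i)) * Complex.exp (s * Complex.I * i) = 1 := by
        rw [Complex.star_def, ← Complex.exp_conj, ← Complex.exp_add]
        simp
      rw [this, one_smul]
    · rw [smul_mul_smul_comm, heo i j hj.symm, smul_zero]
  have h2 : ‖weight e N (s * Complex.I)‖ * ‖weight e N (s * Complex.I)‖ ≤ 1 := by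
    rw [← CStarRing.norm_star_mul_self, h]
    exact IsStarProjection.norm_le _ (isStarProjection_sum_range he heo N)
  nlinarith [norm_nonneg (weight e N (s * Complex.I))]

end Weights

section NestEstimate

variable {X : Type*} [NormedAddCommGroup X] [NormedSpace ℂ X] [CompleteSpace X]
  {A : Type*} [CStarAlgebra A] {δ : X →L[ℂ] X}

theorem norm_weight_conj_le {e f : ℕ → A} (he : ∀ i, ‖e i‖ ≤ 1) (hf : ∀ i, ‖f i‖ ≤ 1) (N : ℕ)
    {m : A} {C r : ℝ} {a : ℤ} (hm : ‖m‖ ≤ C * Real.exp (3 * |r| + a * r))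
    (h0 : ∀ i j : ℕ, 3 < |(i : ℤ) - j - a| → e i * m * f j = 0) :
    ‖weight e N (-r) * m * weight f N r‖ ≤ N * (N * (C * Real.exp (6 * |r|))) := by
  have hC : 0 ≤ C := by
    by_contra hC
    have := mul_neg_of_neg_of_pos (not_le.1 hC) (Real.exp_pos (3 * |r| + a * r))
    linarith [norm_nonneg m]
  have e1 : weight e N (-r) * m * weight f N r = ∑ i ∈ Finset.range N, ∑ j ∈ Finset.range N,
      (Complex.exp (-r * i) * Complex.exp (r * j)) • (e i * m * f j) := by
    simp only [weight]
    rw [Finset.sum_mul, Finset.sum_mul_sum]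
    refine Finset.sum_congr rfl fun i _ => Finset.sum_congr rfl fun j _ => ?_
    rw [smul_mul_assoc, smul_mul_smul_comm]
  rw [e1]
  refine (norm_sum_le _ _).trans ((Finset.sum_le_card_nsmul _ _ (N * (C * Real.exp (6 * |r|)))
    fun i _ => ?_).trans (by simp))
  refine (norm_sum_le _ _).trans ((Finset.sum_le_card_nsmul _ _ (C * Real.exp (6 * |r|))
    fun j _ => ?_).trans (by simp))
  by_cases hij : 3 < |(i : ℤ) - j - a|
  · rw [h0 i j hij, smul_zero, norm_zero]; positivity
  · rw [not_lt] at hij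
    have hij' : |(i : ℝ) - j - a| ≤ 3 := by exact_mod_cast hij
    rw [norm_smul, ← Complex.exp_add, Complex.norm_exp]
    have hre : ((-r * i + r * j : ℂ)).re = -(r * (i - j)) := by simp; ring
    rw [hre]
    have h1 : ‖e i * m * f j‖ ≤ C * Real.exp (3 * |r| + a * r) := by
      calc ‖e i * m * f j‖ ≤ ‖e i‖ * ‖m‖ * ‖f j‖ :=
            (norm_mul_le _ _).trans (by gcongr; exact norm_mul_le _ _)
        _ ≤ 1 * ‖m‖ * 1 := by gcongr; exacts [he i, hf j]
        _ ≤ _ := by simpa using hm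
    calc _ ≤ Real.exp (-(r * (i - j))) * (C * Real.exp (3 * |r| + a * r)) := by gcongr
      _ = C * Real.exp (-(r * (i - j - a)) + 3 * |r|) := by
        rw [mul_left_comm, ← Real.exp_add]; congr 2; ring
      _ ≤ C * Real.exp (6 * |r|) := by
        gcongr
        have h2 : |r * ((i : ℝ) - j - a)| ≤ |r| * 3 := by rw [abs_mul]; gcongr
        linarith [neg_abs_le (r * ((i : ℝ) - j - a))]

theorem norm_derivation_sub_grading_le (hδ : ∀ s : ℝ, ‖flow δ ((s : ℂ) * Complex.I)‖ ≤ 1)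
    (ρ : X →L[ℂ] A) (hρ : ∀ x, ‖ρ x‖ ≤ ‖x‖) {e f : ℕ → A} (N : ℕ)
    (he : ∀ i, IsStarProjection (e i)) (heo : ∀ i j, i ≠ j → e i * e j = 0)
    (hf : ∀ i, IsStarProjection (f i)) (hfo : ∀ i j, i ≠ j → f i * f j = 0)
    (heρ : ∀ x, (∑ i ∈ Finset.range N, e i) * ρ x = ρ x)
    (hρf : ∀ x, ρ x * (∑ i ∈ Finset.range N, f i) = ρ x)
    (hloc : ∀ y ∈ localizedVectors δ, ∃ a : ℤ, ∃ C : ℝ,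
      (∀ r : ℝ, ‖flow δ r y‖ ≤ C * Real.exp (3 * |r| + a * r)) ∧
      ∀ (r : ℝ) (i j : ℕ), 3 < |(i : ℤ) - j - a| → e i * ρ (flow δ r y) * f j = 0) (x : X) :
    ‖ρ (δ x) - ((∑ i ∈ Finset.range N, (i : ℂ) • e i) * ρ x
      - ρ x * ∑ i ∈ Finset.range N, (i : ℂ) • f i)‖ ≤ Real.exp 6 * ‖x‖ := by
  have he1 : ∀ i, ‖e i‖ ≤ 1 := fun i => (he i).norm_le
  have hf1 : ∀ i, ‖f i‖ ≤ 1 := fun i => (hf i).norm_le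
  set h := ∑ i ∈ Finset.range N, (i : ℂ) • e i with hh
  set k := ∑ i ∈ Finset.range N, (i : ℂ) • f i with hk
  let F : X → ℂ → A := fun x z => weight e N (-z) * ρ (flow δ z x) * weight f N z
  have hflow : ∀ x z, HasDerivAt (fun z => ρ (flow δ z x)) (ρ (δ (flow δ z x))) z := fun x z =>
    ρ.hasFDerivAt.comp_hasDerivAt z (hasDerivAt_flow z x)
  have hdiff : ∀ x, Differentiable ℂ (F x) := fun x =>
    (((differentiable_weight e N).comp differentiable_neg).mul
      fun z => (hflow x z).differentiableAt).mul (differentiable_weight f N)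
  have hF' : ∀ x, deriv (F x) 0 = ρ (δ x) - (h * ρ x - ρ x * k) := by
    intro x
    have h1 : HasDerivAt (fun z => weight e N (-z)) (-h) 0 := by
      have := (hasDerivAt_weight e N)
      rw [← neg_zero] at this
      exact (this.scomp (0 : ℂ) (hasDerivAt_neg (0 : ℂ))).congr_deriv (by simp [hh])
    have := ((h1.fun_mul (hflow x 0)).fun_mul (hasDerivAt_weight f N)).deriv
    rw [show deriv (F x) 0 = _ from this, neg_zero, weight_zero, weight_zero, flow_zero]
    change (-h * ρ x + (∑ i ∈ Finset.range N, e i) * ρ (δ x)) * (∑ i ∈ Finset.range N, f i)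
      + (∑ i ∈ Finset.range N, e i) * ρ x * k = _
    rw [heρ, heρ, add_mul, mul_assoc, hρf, hρf]
    noncomm_ring
  have hgrow : ∀ x z, ‖F x z‖ ≤ (N * ‖x‖ * N) * Real.exp ((2 * N + ‖δ‖) * ‖z‖) := by
    intro x z
    have h1 := norm_weight_le he1 N (-z)
    have h2 := norm_weight_le hf1 N z
    have h3 := (hρ _).trans (norm_flow_apply_le_exp δ z x)
    rw [norm_neg] at h1
    calc ‖F x z‖ ≤ ‖weight e N (-z)‖ * ‖ρ (flow δ z x)‖ * ‖weight f N z‖ :=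
          (norm_mul_le _ _).trans (by gcongr; exact norm_mul_le _ _)
      _ ≤ (N * Real.exp (N * ‖z‖)) * (‖x‖ * Real.exp (‖δ‖ * ‖z‖)) * (N * Real.exp (N * ‖z‖)) := by
          gcongr
      _ = (N * ‖x‖ * N) * (Real.exp (N * ‖z‖) * Real.exp (‖δ‖ * ‖z‖) * Real.exp (N * ‖z‖)) := by
          ring
      _ = _ := by rw [← Real.exp_add, ← Real.exp_add]; congr 2; ring
  have him : ∀ x (s : ℝ), ‖F x (s * Complex.I)‖ ≤ ‖x‖ := by
    intro x s
    have h1 := norm_weight_mul_I_le he heo N (-s)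
    have h2 := norm_weight_mul_I_le hf hfo N s
    have h3 := (hρ _).trans (norm_flow_apply_le hδ s x)
    rw [Complex.ofReal_neg, neg_mul] at h1
    calc ‖F x (s * Complex.I)‖ ≤ ‖weight e N (-(s * Complex.I))‖ *
          ‖ρ (flow δ (s * Complex.I) x)‖ * ‖weight f N (s * Complex.I)‖ :=
          (norm_mul_le _ _).trans (by gcongr; exact norm_mul_le _ _)
      _ ≤ 1 * ‖x‖ * 1 := by gcongr
      _ = ‖x‖ := by ring
  have hre : ∀ x ∈ Submodule.span ℂ (localizedVectors δ),
      ∃ C : ℝ, ∀ r : ℝ, ‖F x r‖ ≤ C * Real.exp (6 * |r|) := by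
    intro x hx
    induction hx using Submodule.span_induction with
    | mem y hy =>
      obtain ⟨a, C, hC, h0⟩ := hloc y hy
      refine ⟨N * (N * C), fun r => ?_⟩
      have := norm_weight_conj_le he1 hf1 N ((hρ _).trans (hC r)) (h0 r)
      exact this.trans (le_of_eq (by ring))
    | zero => exact ⟨0, fun r => by simp [F]⟩
    | add x y _ _ hx hy =>
      obtain ⟨C, hC⟩ := hx
      obtain ⟨C', hC'⟩ := hy
      refine ⟨C + C', fun r => ?_⟩
      have : F (x + y) r = F x r + F y r := by simp [F, mul_add, add_mul]
      rw [this, add_mul]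
      exact (norm_add_le _ _).trans (add_le_add (hC r) (hC' r))
    | smul c x _ hx =>
      obtain ⟨C, hC⟩ := hx
      refine ⟨‖c‖ * C, fun r => ?_⟩
      have : F (c • x) r = c • F x r := by simp [F]
      rw [this, norm_smul, mul_assoc]
      gcongr
      exact hC r
  have hclosed : IsClosed {x : X | ‖ρ (δ x) - (h * ρ x - ρ x * k)‖ ≤ Real.exp 6 * ‖x‖} :=
    isClosed_le (by fun_prop) (by fun_prop)
  refine hclosed.closure_subset_iff.2 (fun x hx => ?_) (mem_closure_span_localizedVectors hδ x)
  obtain ⟨C, hC⟩ := hre x hx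
  have := norm_deriv_zero_le_of_bound_axes (hdiff x) (hgrow x) (him x) hC
  rwa [hF'] at this

end NestEstimate

section Filtration

variable {X : Type*} [NormedAddCommGroup X] [NormedSpace ℂ X]

/-- Vectors whose backward orbit decays at least like `exp (-r * s)`. -/
def lowerGrowth (δ : X →L[ℂ] X) (s : ℤ) : Set X :=
  {x | ∃ C : ℝ, ∀ r : ℝ, 0 ≤ r → ‖flow δ (-r) x‖ ≤ C * Real.exp (-(r * s))}

/-- Vectors whose forward orbit grows at most like `exp (r * s)`. -/
def upperGrowth (δ : X →L[ℂ] X) (s : ℤ) : Set X :=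
  {x | ∃ C : ℝ, ∀ r : ℝ, 0 ≤ r → ‖flow δ r x‖ ≤ C * Real.exp (r * s)}

theorem lowerGrowth_antitone (δ : X →L[ℂ] X) : Antitone (lowerGrowth δ) := by
  rintro s u hsu x ⟨C, hC⟩
  have hC0 : 0 ≤ C := by
    have := (norm_nonneg _).trans (hC 0 le_rfl)
    simpa using this
  refine ⟨C, fun r hr => (hC r hr).trans ?_⟩
  have : (s : ℝ) ≤ u := by exact_mod_cast hsu
  gcongr

variable [CompleteSpace X] {δ : X →L[ℂ] X}

theorem lowerGrowth_eq_univ {s : ℤ} (hs : (s : ℝ) ≤ -‖δ‖) (x : X) : x ∈ lowerGrowth δ s := by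
  refine ⟨‖x‖, fun r hr => (norm_flow_apply_le_exp δ _ x).trans ?_⟩
  rw [norm_neg, Complex.norm_real, Real.norm_eq_abs, abs_of_nonneg hr]
  gcongr
  nlinarith

theorem upperGrowth_eq_univ {s : ℤ} (hs : ‖δ‖ ≤ s) (x : X) : x ∈ upperGrowth δ s := by
  refine ⟨‖x‖, fun r hr => (norm_flow_apply_le_exp δ _ x).trans ?_⟩
  rw [Complex.norm_real, Real.norm_eq_abs, abs_of_nonneg hr, mul_comm ‖δ‖ r]
  gcongr

theorem eq_zero_of_norm_flow_le {x : X} {C c ε : ℝ} (hε : |ε| = 1) (hc : ‖δ‖ < c)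
    (h : ∀ r : ℝ, 0 ≤ r → ‖flow δ ((ε * r : ℝ) : ℂ) x‖ ≤ C * Real.exp (-(r * c))) : x = 0 := by
  have h1 : ∀ r : ℝ, 0 ≤ r → ‖x‖ ≤ C * Real.exp (-(r * (c - ‖δ‖))) := by
    intro r hr
    have e : flow δ (-((ε * r : ℝ) : ℂ)) (flow δ ((ε * r : ℝ) : ℂ) x) = x := by
      rw [← flow_add, neg_add_cancel, flow_zero]; rfl
    have h2 := norm_flow_apply_le_exp δ (-((ε * r : ℝ) : ℂ)) (flow δ ((ε * r : ℝ) : ℂ) x)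
    rw [e, norm_neg, Complex.norm_real, Real.norm_eq_abs, abs_mul, hε, one_mul,
      abs_of_nonneg hr] at h2
    refine h2.trans ((mul_le_mul_of_nonneg_right (h r hr) (Real.exp_pos _).le).trans_eq ?_)
    rw [mul_assoc, ← Real.exp_add]; congr 2; ring
  have hlim : Tendsto (fun r : ℝ => C * Real.exp (-(r * (c - ‖δ‖)))) atTop (𝓝 (C * 0)) := by
    refine Tendsto.const_mul C (Real.tendsto_exp_neg_atTop_nhds_zero.comp ?_)
    exact tendsto_id.atTop_mul_const (by linarith)
  have h3 : ‖x‖ ≤ C * 0 := ge_of_tendsto hlim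
    ((eventually_ge_atTop (0 : ℝ)).mono fun r hr => h1 r hr)
  rw [mul_zero] at h3
  exact norm_le_zero_iff.1 h3

theorem eq_zero_of_mem_lowerGrowth {s : ℤ} (hs : ‖δ‖ < s) {x : X} (hx : x ∈ lowerGrowth δ s) :
    x = 0 := by
  obtain ⟨C, hC⟩ := hx
  exact eq_zero_of_norm_flow_le (ε := -1) (by simp) hs fun r hr => by simpa using hC r hr

theorem eq_zero_of_mem_upperGrowth {s : ℤ} (hs : (s : ℝ) < -‖δ‖) {x : X}
    (hx : x ∈ upperGrowth δ s) : x = 0 := by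
  obtain ⟨C, hC⟩ := hx
  exact eq_zero_of_norm_flow_le (ε := 1) (c := -s) (by simp) (by linarith)
    fun r hr => by simpa using hC r hr

theorem flow_mem_lowerGrowth {s : ℤ} {x : X} (hx : x ∈ lowerGrowth δ s) (z : ℂ) :
    flow δ z x ∈ lowerGrowth δ s := by
  obtain ⟨C, hC⟩ := hx
  refine ⟨‖flow δ z‖ * C, fun r hr => ?_⟩
  rw [← flow_add, add_comm, flow_add, mul_assoc]
  exact ((flow δ z).le_opNorm _).trans (by gcongr; exact hC r hr)

theorem flow_mem_upperGrowth {s : ℤ} {x : X} (hx : x ∈ upperGrowth δ s) (z : ℂ) :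
    flow δ z x ∈ upperGrowth δ s := by
  obtain ⟨C, hC⟩ := hx
  refine ⟨‖flow δ z‖ * C, fun r hr => ?_⟩
  rw [← flow_add, add_comm, flow_add, mul_assoc]
  exact ((flow δ z).le_opNorm _).trans (by gcongr; exact hC r hr)

theorem mem_growth_of_norm_flow_le {y : X} {a : ℤ} {C : ℝ}
    (h : ∀ r : ℝ, ‖flow δ r y‖ ≤ C * Real.exp (3 * |r| + a * r)) :
    y ∈ lowerGrowth δ (a - 3) ∧ y ∈ upperGrowth δ (a + 3) := by
  refine ⟨⟨C, fun r hr => ?_⟩, ⟨C, fun r hr => ?_⟩⟩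
  · have := h (-r)
    rw [abs_neg, abs_of_nonneg hr, Complex.ofReal_neg] at this
    convert this using 3
    push_cast; ring
  · have := h r
    rw [abs_of_nonneg hr] at this
    convert this using 3
    push_cast; ring

theorem ternary_mem_lowerGrowth {B : Type*} [CStarAlgebra B] {ι : X →ₗᵢ[ℂ] B}
    {t : X → X → X → X} (ht : ∀ x y z, ι (t x y z) = ι x * star (ι y) * ι z)
    (hδ : ∀ x y z, ι (δ (t x y z)) = ι (δ x) * star (ι y) * ι z - ι x * star (ι (δ y)) * ι z
      + ι x * star (ι y) * ι (δ z)) {s u v : ℤ} {x y w : X} (hx : x ∈ lowerGrowth δ s)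
    (hy : y ∈ upperGrowth δ u) (hw : w ∈ lowerGrowth δ v) :
    t x y w ∈ lowerGrowth δ (s - u + v) := by
  obtain ⟨Cx, hx⟩ := hx
  obtain ⟨Cy, hy⟩ := hy
  obtain ⟨Cw, hw⟩ := hw
  refine ⟨Cx * Cy * Cw, fun r hr => ?_⟩
  have h1 := map_flow_ternary ht hδ 1 (-r) x y w
  simp only [Complex.ofReal_neg, star_one, mul_one, neg_neg] at h1
  rw [← ι.norm_map, h1]
  calc _ ≤ ‖flow δ (-r) x‖ * ‖flow δ r y‖ * ‖flow δ (-r) w‖ := by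
        refine (norm_mul_le _ _).trans ?_
        rw [ι.norm_map]
        gcongr
        refine (norm_mul_le _ _).trans ?_
        rw [norm_star, ι.norm_map, ι.norm_map]
    _ ≤ (Cx * Real.exp (-(r * s))) * (Cy * Real.exp (r * u)) * (Cw * Real.exp (-(r * v))) := by
        have hx' := hx r hr
        have hy' := hy r hr
        have hw' := hw r hr
        have := (norm_nonneg _).trans hx'
        have := (norm_nonneg _).trans hy'
        gcongr
    _ = (Cx * Cy * Cw) * (Real.exp (-(r * s)) * Real.exp (r * u) * Real.exp (-(r * v))) := by ring
    _ = _ := by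
        rw [← Real.exp_add, ← Real.exp_add]; congr 2; push_cast; ring

end Filtration

section Projections

variable {G : Type*} [NormedAddCommGroup G] [InnerProductSpace ℂ G] [CompleteSpace G]

theorem starProjection_mul_of_le {U V : Submodule ℂ G} [U.HasOrthogonalProjection]
    [V.HasOrthogonalProjection] (h : U ≤ V) :
    U.starProjection * V.starProjection = U.starProjection ∧
      V.starProjection * U.starProjection = U.starProjection := by
  have h1 : U.starProjection * V.starProjection = U.starProjection :=
    Submodule.starProjection_comp_starProjection_of_le h
  refine ⟨h1, ?_⟩
  have h2 := congrArg star h1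
  rwa [star_mul, isStarProjection_starProjection.isSelfAdjoint.star_eq,
    isStarProjection_starProjection.isSelfAdjoint.star_eq] at h2

theorem starProjection_eq_zero_of_eq_bot {U : Submodule ℂ G} [U.HasOrthogonalProjection]
    (h : U = ⊥) : U.starProjection = 0 := by
  ext ξ
  exact (Submodule.mem_bot ℂ).1 (h.le (Submodule.starProjection_apply_mem U ξ))

theorem sum_natCast_smul_sub {A : Type*} [AddCommGroup A] [Module ℂ A] (q : ℕ → A) (N : ℕ) :
    ∑ i ∈ Finset.range N, (i : ℂ) • (q i - q (i + 1))
      = ∑ i ∈ Finset.range N, q (i + 1) - (N : ℂ) • q N := by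
  induction N with
  | zero => simp
  | succ N ih =>
    rw [Finset.sum_range_succ, ih, Finset.sum_range_succ]
    push_cast
    rw [add_smul, smul_sub, one_smul]
    abel

variable {X : Type*} [NormedAddCommGroup X] [NormedSpace ℂ X] [CompleteSpace X] {δ : X →L[ℂ] X}

theorem norm_derivation_sub_filtration_le
    (hδ : ∀ s : ℝ, ‖flow δ ((s : ℂ) * Complex.I)‖ ≤ 1)
    (ρ : X →L[ℂ] (G →L[ℂ] G)) (hρ : ∀ x, ‖ρ x‖ ≤ ‖x‖) (Q P : ℤ → Submodule ℂ G)
    [∀ i, (Q i).HasOrthogonalProjection] [∀ i, (P i).HasOrthogonalProjection]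
    (hQ : Antitone Q) (hP : Antitone P) (L N : ℕ) (hQN : Q (N - L) = ⊥) (hPN : P (N - L) = ⊥)
    (hQ0 : ∀ x, (Q (-L)).starProjection * ρ x = ρ x)
    (hP0 : ∀ x, ρ x * (P (-L)).starProjection = ρ x)
    (hQP : ∀ s, ∀ x ∈ lowerGrowth δ s, ∀ j, ∀ ξ ∈ P j, ρ x ξ ∈ Q (j + s))
    (hPQ : ∀ u, ∀ y ∈ upperGrowth δ u, ∀ i, ∀ ξ ∈ Q i, star (ρ y) ξ ∈ P (i - u)) (x : X) :
    ‖ρ (δ x) - ((∑ i ∈ Finset.range N, (Q ((i + 1 : ℕ) - L)).starProjection) * ρ x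
      - ρ x * ∑ i ∈ Finset.range N, (P ((i + 1 : ℕ) - L)).starProjection)‖
      ≤ Real.exp 6 * ‖x‖ := by
  have main : ∀ (R : ℤ → Submodule ℂ G) [∀ i, (R i).HasOrthogonalProjection], Antitone R →
      (∀ i : ℕ, IsStarProjection ((R (i - L)).starProjection - (R ((i + 1 : ℕ) - L)).starProjection))
      ∧ (∀ i j : ℕ, i ≠ j → ((R (i - L)).starProjection - (R ((i + 1 : ℕ) - L)).starProjection) *
        ((R (j - L)).starProjection - (R ((j + 1 : ℕ) - L)).starProjection) = 0) := by
    intro R _ hR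
    have hle : ∀ i j : ℕ, i ≤ j → R (j - L) ≤ R (i - L) := fun i j hij =>
      hR (by gcongr)
    refine ⟨fun i => ?_, fun i j hij => ?_⟩
    · exact isStarProjection_starProjection.sub_of_mul_eq_left isStarProjection_starProjection
        (starProjection_mul_of_le (hle i (i + 1) (by omega))).1
    · rcases lt_or_gt_of_ne hij with h | h
      · rw [sub_mul, mul_sub, mul_sub, (starProjection_mul_of_le (hle i j (by omega))).2,
          (starProjection_mul_of_le (hle i (j + 1) (by omega))).2,
          (starProjection_mul_of_le (hle (i + 1) j (by omega))).2,
          (starProjection_mul_of_le (hle (i + 1) (j + 1) (by omega))).2, sub_self]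
      · rw [sub_mul, mul_sub, mul_sub, (starProjection_mul_of_le (hle j i (by omega))).1,
          (starProjection_mul_of_le (hle j (i + 1) (by omega))).1,
          (starProjection_mul_of_le (hle (j + 1) i (by omega))).1,
          (starProjection_mul_of_le (hle (j + 1) (i + 1) (by omega))).1]
        abel
  have kill : ∀ (R : ℤ → Submodule ℂ G) [∀ i, (R i).HasOrthogonalProjection], Antitone R →
      ∀ (i : ℕ) (m : ℤ), (i : ℤ) + 1 - L ≤ m → ∀ ξ ∈ R m,
      ((R (i - L)).starProjection - (R ((i + 1 : ℕ) - L)).starProjection) ξ = 0 := by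
    intro R _ hR i m hm ξ hξ
    rw [sub_apply, Submodule.starProjection_eq_self_iff.2 (hR (show (i : ℤ) - L ≤ m by omega) hξ),
      Submodule.starProjection_eq_self_iff.2
        (hR (show ((i + 1 : ℕ) : ℤ) - L ≤ m by push_cast; omega) hξ), sub_self]
  have keep : ∀ (R : ℤ → Submodule ℂ G) [∀ i, (R i).HasOrthogonalProjection], Antitone R →
      ∀ (i : ℕ) (ξ : G),
      ((R (i - L)).starProjection - (R ((i + 1 : ℕ) - L)).starProjection) ξ ∈ R (i - L) := by
    intro R _ hR i ξ
    exact Submodule.sub_mem _ (Submodule.starProjection_apply_mem _ _)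
      (hR (by push_cast; omega) (Submodule.starProjection_apply_mem _ _))
  obtain ⟨he, heo⟩ := main Q hQ
  obtain ⟨hf, hfo⟩ := main P hP
  have tele : ∀ (R : ℤ → Submodule ℂ G) [∀ i, (R i).HasOrthogonalProjection], R (N - L) = ⊥ →
      ∑ i ∈ Finset.range N, ((R ((i : ℕ) - L)).starProjection
        - (R ((i + 1 : ℕ) - L)).starProjection) = (R (-L)).starProjection := by
    intro R _ hN
    have h := Finset.sum_range_sub' (fun i : ℕ => (R (i - L)).starProjection) N
    have h0 := starProjection_eq_zero_of_eq_bot hN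
    rw [h, h0, sub_zero]
    simp
  have tele' : ∀ (R : ℤ → Submodule ℂ G) [∀ i, (R i).HasOrthogonalProjection], R (N - L) = ⊥ →
      ∑ i ∈ Finset.range N, (i : ℂ) • ((R ((i : ℕ) - L)).starProjection
        - (R ((i + 1 : ℕ) - L)).starProjection)
        = ∑ i ∈ Finset.range N, (R ((i + 1 : ℕ) - L)).starProjection := by
    intro R _ hN
    have h := sum_natCast_smul_sub (fun i : ℕ => (R (i - L)).starProjection) N
    have h0 := starProjection_eq_zero_of_eq_bot hN
    rw [h, h0, smul_zero, sub_zero]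
  have key := norm_derivation_sub_grading_le hδ ρ hρ N he heo hf hfo
    (fun x => by rw [tele Q hQN, hQ0]) (fun x => by rw [tele P hPN, hP0]) ?_ x
  · rwa [tele' Q hQN, tele' P hPN] at key
  · intro y hy
    obtain ⟨a, C, hC⟩ := norm_flow_le_of_mem_localizedVectors hy
    refine ⟨a, C, hC, fun r i j hij => ?_⟩
    obtain ⟨hl, hu⟩ := mem_growth_of_norm_flow_le hC
    have hl' := flow_mem_lowerGrowth hl r
    have hu' := flow_mem_upperGrowth hu r
    rcases lt_abs.1 hij with h | h
    · rw [← star_inj, star_zero, star_mul, star_mul, (he i).isSelfAdjoint.star_eq,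
        (hf j).isSelfAdjoint.star_eq]
      ext ξ
      exact kill P hP j _ (by omega) _ (hPQ _ _ hu' _ _ (keep Q hQ i ξ))
    · ext ξ
      exact kill Q hQ i _ (by omega) _ (hQP _ _ hl' _ _ (keep P hP j ξ))

end Projections

section Concrete

variable {G : Type*} [NormedAddCommGroup G] [InnerProductSpace ℂ G] [CompleteSpace G]

/-- The closed linear span of the ranges of a family of operators. -/
def essentialRange (S : Set (G →L[ℂ] G)) : Submodule ℂ G :=
  (⨆ T : S, (T : G →L[ℂ] G).range).topologicalClosure

noncomputable instance (S : Set (G →L[ℂ] G)) : (essentialRange S).HasOrthogonalProjection := by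
  unfold essentialRange; infer_instance

theorem apply_mem_essentialRange {S : Set (G →L[ℂ] G)} {T : G →L[ℂ] G} (hT : T ∈ S) (ξ : G) :
    T ξ ∈ essentialRange S :=
  Submodule.le_topologicalClosure _ (Submodule.mem_iSup_of_mem ⟨T, hT⟩ ⟨ξ, rfl⟩)

theorem map_essentialRange {S : Set (G →L[ℂ] G)} {U : Submodule ℂ G} (hU : IsClosed (U : Set G))
    (M : G →L[ℂ] G) (h : ∀ T ∈ S, ∀ ξ, M (T ξ) ∈ U) {ξ : G} (hξ : ξ ∈ essentialRange S) :
    M ξ ∈ U := by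
  have : essentialRange S ≤ U.comap (M : G →ₗ[ℂ] G) := by
    refine Submodule.topologicalClosure_minimal _ (iSup_le fun T => ?_) (hU.preimage M.continuous)
    rintro _ ⟨η, rfl⟩
    exact h T T.2 η
  exact this hξ

theorem isClosed_essentialRange (S : Set (G →L[ℂ] G)) : IsClosed (essentialRange S : Set G) :=
  Submodule.isClosed_topologicalClosure _

theorem essentialRange_mono {S T : Set (G →L[ℂ] G)} (h : S ⊆ T) :
    essentialRange S ≤ essentialRange T := fun _ hξ =>
  map_essentialRange (isClosed_essentialRange T) (ContinuousLinearMap.id ℂ G)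
    (fun _ hA η => apply_mem_essentialRange (h hA) η) hξ

theorem essentialRange_eq_bot {S : Set (G →L[ℂ] G)} (h : ∀ T ∈ S, T = 0) :
    essentialRange S = ⊥ := by
  refine eq_bot_iff.2 fun ξ hξ => ?_
  exact map_essentialRange (U := ⊥) isClosed_singleton (ContinuousLinearMap.id ℂ G)
    (fun T hT η => by rw [h T hT]; simp) hξ

variable {X : Type*} [NormedAddCommGroup X] [NormedSpace ℂ X] [CompleteSpace X] {δ : X →L[ℂ] X}
  {B : Type*} [CStarAlgebra B] {ι : X →ₗᵢ[ℂ] B} {t : X → X → X → X}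

/-- The operators `ρ x` with `x` in a spectral subspace. -/
def leftOperators (δ : X →L[ℂ] X) (ρ : X → G →L[ℂ] G) (i : ℤ) : Set (G →L[ℂ] G) :=
  ρ '' lowerGrowth δ i

/-- The operators `star (ρ y) * ρ x` whose spectral degree is at least `j`. -/
def rightOperators (δ : X →L[ℂ] X) (ρ : X → G →L[ℂ] G) (j : ℤ) : Set (G →L[ℂ] G) :=
  {T | ∃ (u : ℤ) (y x : X), y ∈ upperGrowth δ u ∧ x ∈ lowerGrowth δ (u + j) ∧
    T = star (ρ y) * ρ x}

theorem exists_filtration_estimate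
    (ht : ∀ x y z, ι (t x y z) = ι x * star (ι y) * ι z)
    (hδ : ∀ x y z, ι (δ (t x y z)) = ι (δ x) * star (ι y) * ι z - ι x * star (ι (δ y)) * ι z
      + ι x * star (ι y) * ι (δ z)) (π : B →⋆ₐ[ℂ] (G →L[ℂ] G)) :
    ∃ (N : ℕ) (l : ℕ → ℤ), ∀ x : X,
      ‖π (ι (δ x)) - ((∑ i ∈ Finset.range N,
          (essentialRange (leftOperators δ (fun x => π (ι x)) (l i))).starProjection) * π (ι x)
        - π (ι x) * ∑ i ∈ Finset.range N,
          (essentialRange (rightOperators δ (fun x => π (ι x)) (l i))).starProjection)‖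
      ≤ Real.exp 6 * ‖x‖ := by
  have hρ : ∀ x, ‖π (ι x)‖ ≤ ‖x‖ := fun x =>
    (NonUnitalStarAlgHom.norm_apply_le π (ι x)).trans (ι.norm_map x).le
  let ρ : X →L[ℂ] (G →L[ℂ] G) := LinearMap.mkContinuous
    (π.toAlgHom.toLinearMap.comp ι.toLinearMap) 1 (fun x => by simpa using hρ x)
  have hρt : ∀ x y z, ρ (t x y z) = ρ x * star (ρ y) * ρ z := fun x y z => by
    change π (ι (t x y z)) = π (ι x) * star (π (ι y)) * π (ι z)
    rw [ht, map_mul, map_mul, map_star]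
  let Q : ℤ → Submodule ℂ G := fun i => essentialRange (leftOperators δ ρ i)
  let P : ℤ → Submodule ℂ G := fun i => essentialRange (rightOperators δ ρ i)
  let M : ℕ := ⌈‖δ‖⌉₊
  have hM : ‖δ‖ ≤ M := Nat.le_ceil _
  have hQz : ∀ i : ℤ, M < i → Q i = ⊥ := by
    rintro i hi
    refine essentialRange_eq_bot ?_
    rintro _ ⟨x, hx, rfl⟩
    have hi' : (M : ℝ) < i := by exact_mod_cast hi
    rw [eq_zero_of_mem_lowerGrowth (hM.trans_lt hi') hx, map_zero]
  have hPz : ∀ j : ℤ, 2 * M < j → P j = ⊥ := by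
    rintro j hj
    refine essentialRange_eq_bot ?_
    rintro _ ⟨u, y, x, hy, hx, rfl⟩
    rcases lt_or_ge u (-M : ℤ) with h | h
    · have h' : (u : ℝ) < -M := by exact_mod_cast h
      rw [eq_zero_of_mem_upperGrowth (by linarith) hy, map_zero, star_zero, zero_mul]
    · have h' : (M : ℝ) < (u + j : ℤ) := by
        have : (M : ℤ) < u + j := by omega
        exact_mod_cast this
      rw [eq_zero_of_mem_lowerGrowth (hM.trans_lt h') hx, map_zero, mul_zero]
  refine ⟨4 * M + 1, fun i => (i + 1 : ℕ) - (2 * M : ℕ), fun x => ?_⟩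
  refine norm_derivation_sub_filtration_le (norm_flow_mul_I_le ht hδ) ρ hρ Q P ?_ ?_
    (2 * M) (4 * M + 1) (hQz _ (by push_cast; omega)) (hPz _ (by push_cast; omega)) ?_ ?_ ?_ ?_ x
  · exact fun i j hij => essentialRange_mono (Set.image_mono (lowerGrowth_antitone δ hij))
  · refine fun i j hij => essentialRange_mono ?_
    rintro _ ⟨u, y, x, hy, hx, rfl⟩
    exact ⟨u, y, x, hy, lowerGrowth_antitone δ (by omega) hx, rfl⟩
  · intro x
    ext ξ
    have hx : x ∈ lowerGrowth δ (-(2 * M : ℕ)) :=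
      lowerGrowth_eq_univ (by push_cast; linarith [norm_nonneg δ]) x
    exact Submodule.starProjection_eq_self_iff.2
      (apply_mem_essentialRange (Set.mem_image_of_mem ρ hx) ξ)
  · intro x
    ext ξ
    have h1 := Submodule.sub_starProjection_mem_orthogonal (K := P (-(2 * M : ℕ))) ξ
    set w := ξ - (P (-(2 * M : ℕ))).starProjection ξ with hw
    have h2 : star (ρ x) (ρ x w) ∈ P (-(2 * M : ℕ)) := by
      refine apply_mem_essentialRange (S := rightOperators δ ρ _) (T := star (ρ x) * ρ x)
        ⟨M, x, x, upperGrowth_eq_univ (by exact_mod_cast hM) x,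
          lowerGrowth_eq_univ ?_ x, rfl⟩ w
      push_cast; linarith
    have h3 := (Submodule.mem_orthogonal _ _).1 h1 _ h2
    rw [star_eq_adjoint, adjoint_inner_left, inner_self_eq_zero, hw, map_sub, sub_eq_zero] at h3
    exact h3.symm
  · intro s x hx j ξ hξ
    refine map_essentialRange (isClosed_essentialRange _) (ρ x) ?_ hξ
    rintro _ ⟨u, y, z, hy, hz, rfl⟩ η
    have h1 := ternary_mem_lowerGrowth ht hδ hx hy hz
    rw [show s - u + (u + j) = j + s by ring] at h1
    have h2 := apply_mem_essentialRange (Set.mem_image_of_mem ρ h1) η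
    rwa [hρt, mul_assoc] at h2
  · intro u y hy i ξ hξ
    refine map_essentialRange (isClosed_essentialRange _) (star (ρ y)) ?_ hξ
    rintro _ ⟨x, hx, rfl⟩ η
    exact apply_mem_essentialRange (S := rightOperators δ ρ _) (T := star (ρ y) * ρ x)
      ⟨u, y, x, hy, by rwa [add_sub_cancel], rfl⟩ η

end Concrete

section StrongLimits

variable {G : Type*} [NormedAddCommGroup G] [InnerProductSpace ℂ G] [CompleteSpace G]

theorem norm_one_sub_smul_le {b : G →L[ℂ] G} (hb : 0 ≤ b) :
    ‖1 - ((‖b‖ + 1)⁻¹ : ℝ) • b‖ ≤ 1 := by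
  have hpos : 0 ≤ (‖b‖ + 1)⁻¹ := by positivity
  have h0 : 0 ≤ ((‖b‖ + 1)⁻¹ : ℝ) • b := smul_nonneg hpos hb
  have h1 : ((‖b‖ + 1)⁻¹ : ℝ) • b ≤ 1 := by
    rw [← CStarAlgebra.norm_le_one_iff_of_nonneg _ h0, norm_smul, Real.norm_of_nonneg hpos,
      inv_mul_le_one₀ (by positivity)]
    linarith
  rw [CStarAlgebra.norm_le_one_iff_of_nonneg _ (sub_nonneg.2 h1)]
  exact sub_le_self _ h0

theorem ker_sum_mul_star (V : Finset (G →L[ℂ] G)) :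
    (∑ g ∈ V, g * star g).ker = (essentialRange (V : Set (G →L[ℂ] G)))ᗮ := by
  ext ξ
  rw [essentialRange, Submodule.orthogonal_closure, ← Submodule.iInf_orthogonal,
    Submodule.mem_iInf]
  simp_rw [orthogonal_range, Subtype.forall]
  have key : ∀ g : G →L[ℂ] G, inner ℂ ξ ((g * star g) ξ) = ((‖star g ξ‖ ^ 2 : ℝ) : ℂ) := by
    intro g
    rw [mul_apply_eq_comp, ← adjoint_inner_left, ← star_eq_adjoint, inner_self_eq_norm_sq_to_K]
    push_cast; rfl
  constructor
  · intro h g hg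
    have h1 : inner ℂ ξ ((∑ g ∈ V, g * star g) ξ) = 0 := by
      rw [show (∑ g ∈ V, g * star g) ξ = 0 from h, inner_zero_right]
    simp_rw [sum_apply, inner_sum, key] at h1
    rw [← Complex.ofReal_sum, Complex.ofReal_eq_zero,
      Finset.sum_eq_zero_iff_of_nonneg fun _ _ => by positivity] at h1
    have h2 := h1 g hg
    rw [sq_eq_zero_iff, norm_eq_zero] at h2
    exact h2
  · intro h
    change (∑ g ∈ V, g * star g) ξ = 0
    rw [sum_apply]
    refine Finset.sum_eq_zero fun g hg => ?_
    have h2 : star g ξ = 0 := h g hg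
    rw [mul_apply_eq_comp, h2, map_zero]

theorem one_sub_pow_mem {A : Type*} [Ring A] [StarRing A] [Algebra ℂ A] [StarModule ℂ A]
    {𝒜 : Submodule ℂ A} (hmul : ∀ a ∈ 𝒜, ∀ b ∈ 𝒜, a * b ∈ 𝒜) {b : A} (hb : b ∈ 𝒜) (k : ℕ) :
    1 - (1 - b) ^ k ∈ 𝒜 := by
  induction k with
  | zero => simp
  | succ k ih =>
    have : 1 - (1 - b) ^ (k + 1) = (1 - (1 - b) ^ k) + b - (1 - (1 - b) ^ k) * b := by
      rw [pow_succ]; noncomm_ring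
    rw [this]
    exact 𝒜.sub_mem (𝒜.add_mem ih hb) (hmul _ ih _ hb)

theorem tendsto_average_starProjection {b : G →L[ℂ] G} (hb : 0 ≤ b) {U : Submodule ℂ G}
    [U.HasOrthogonalProjection] (hU : b.ker = Uᗮ) (ξ : G) :
    Tendsto (fun n : ℕ => ((n : ℝ)⁻¹ • ∑ k ∈ Finset.range n,
      (1 - (1 - ((‖b‖ + 1)⁻¹ : ℝ) • b) ^ k)) ξ) atTop (𝓝 (U.starProjection ξ)) := by
  set f : G →L[ℂ] G := 1 - ((‖b‖ + 1)⁻¹ : ℝ) • b with hf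
  have h := tendsto_birkhoffAverage_orthogonalProjection f (norm_one_sub_smul_le hb) ξ
  have h1 : f.eqLocus (1 : G →L[ℂ] G) = Uᗮ := by
    rw [← hU]
    ext η
    have : ‖b‖ + 1 ≠ 0 := by positivity
    simp [hf, this]
  have h2 : (((f.eqLocus (1 : G →L[ℂ] G)).orthogonalProjectionOnto ξ : _) : G)
      = ξ - U.starProjection ξ := by
    rw [← Submodule.starProjection_orthogonal_val, ← Submodule.starProjection_apply]
    congr!
  rw [h2] at h
  have h3 := h.const_sub ξ
  rw [sub_sub_cancel] at h3
  refine h3.congr' ?_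
  filter_upwards [eventually_ne_atTop 0] with n hn
  have hn' : (n : ℝ) ≠ 0 := by exact_mod_cast hn
  rw [birkhoffAverage_congr_ring ℂ ℝ, birkhoffAverage, birkhoffSum, smul_apply, sum_apply]
  simp_rw [sub_apply, _root_.id, Finset.sum_sub_distrib, one_apply_eq_self, Finset.sum_const, Finset.card_range,
    smul_sub, ← Nat.cast_smul_eq_nsmul ℝ, inv_smul_smul₀ hn', ← FunLike.coe_pow_eq_iterate]

variable {κ : Type*}

theorem re_sum_inner_eq_zero_of_tendsto {α : Type*} {l : Filter α} [l.NeBot] (F : Finset κ)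
    (η ζ : κ → G) {T : α → G →L[ℂ] G} {T' : G →L[ℂ] G}
    (hT : ∀ ξ, Tendsto (fun n => T n ξ) l (𝓝 (T' ξ)))
    (h0 : ∀ n, (∑ k ∈ F, inner ℂ (η k) (T n (ζ k))).re = 0) :
    (∑ k ∈ F, inner ℂ (η k) (T' (ζ k))).re = 0 := by
  have h1 : Tendsto (fun n => (∑ k ∈ F, inner ℂ (η k) (T n (ζ k))).re) l
      (𝓝 (∑ k ∈ F, inner ℂ (η k) (T' (ζ k))).re) :=
    (Complex.continuous_re.tendsto _).comp
      (tendsto_finsetSum _ fun k _ => tendsto_const_nhds.inner (hT (ζ k)))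
  simp_rw [h0] at h1
  exact (tendsto_nhds_unique h1 tendsto_const_nhds)

/-- A functional that vanishes on the self-adjoint part of an algebra of operators vanishes on the
range projections of that algebra. -/
theorem re_sum_inner_starProjection_eq_zero (F : Finset κ) (η ζ : κ → G) (S : Set (G →L[ℂ] G))
    (𝒜 : Submodule ℂ (G →L[ℂ] G)) (hmul : ∀ a ∈ 𝒜, ∀ b ∈ 𝒜, a * b ∈ 𝒜)
    (hS : ∀ g ∈ S, g * star g ∈ 𝒜)
    (hΛ : ∀ a ∈ 𝒜, IsSelfAdjoint a → (∑ k ∈ F, inner ℂ (η k) (a (ζ k))).re = 0) :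
    (∑ k ∈ F, inner ℂ (η k) ((essentialRange S).starProjection (ζ k))).re = 0 := by
  have fin : ∀ V : Finset (G →L[ℂ] G), (V : Set (G →L[ℂ] G)) ⊆ S → (∑ k ∈ F, inner ℂ (η k)
      ((essentialRange (V : Set (G →L[ℂ] G))).starProjection (ζ k))).re = 0 := by
    intro V hV
    have hb : 0 ≤ ∑ g ∈ V, g * star g := Finset.sum_nonneg fun g _ => mul_star_self_nonneg g
    refine re_sum_inner_eq_zero_of_tendsto F η ζ
      (tendsto_average_starProjection hb (ker_sum_mul_star V)) fun n => hΛ _ ?_ ?_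
    · refine 𝒜.smul_of_tower_mem _ (𝒜.sum_mem fun k _ => one_sub_pow_mem hmul ?_ k)
      exact 𝒜.smul_of_tower_mem _ (𝒜.sum_mem fun g hg => hS g (hV hg))
    · have hs := hb.isSelfAdjoint
      have h1 : IsSelfAdjoint (1 : G →L[ℂ] G) := .one _
      have h2 := h1.sub ((IsSelfAdjoint.all ((‖∑ g ∈ V, g * star g‖ + 1)⁻¹ : ℝ)).smul hs)
      exact (IsSelfAdjoint.all ((n : ℝ)⁻¹)).smul
        (isSelfAdjoint_sum _ fun k _ => h1.sub (h2.pow k))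
  classical
  let U : Finset S → Submodule ℂ G := fun V =>
    essentialRange (V.map (Function.Embedding.subtype _) : Finset (G →L[ℂ] G))
  have hVS : ∀ V : Finset S,
      ((V.map (Function.Embedding.subtype _) : Finset (G →L[ℂ] G)) : Set (G →L[ℂ] G)) ⊆ S := by
    intro V g hg
    obtain ⟨g', _, rfl⟩ := Finset.mem_map.1 (Finset.mem_coe.1 hg)
    exact g'.2
  have hU : Monotone U := fun V W h => essentialRange_mono (by
    exact_mod_cast Finset.map_subset_map.2 h)
  have hsup : (⨆ V, U V).topologicalClosure = essentialRange S := by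
    refine le_antisymm (Submodule.topologicalClosure_minimal _ (iSup_le fun V =>
      essentialRange_mono (hVS V)) (isClosed_essentialRange S)) ?_
    refine Submodule.topologicalClosure_mono (iSup_le fun g => le_trans ?_ (le_iSup U {g}))
    rintro _ ⟨ξ, rfl⟩
    exact apply_mem_essentialRange (by simp) ξ
  have lim := fun ξ => Submodule.starProjection_tendsto_closure_iSup U hU ξ
  refine re_sum_inner_eq_zero_of_tendsto (l := atTop) F η ζ (T := fun V => (U V).starProjection)
    (fun ξ => ?_) (fun V => fin _ (hVS V))
  convert! lim ξ
  exact hsup.symm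

end StrongLimits

section Domination

open scoped ComplexOrder

variable {B : Type*} [CStarAlgebra B] [PartialOrder B] [StarOrderedRing B]

theorem star_mul_self_combination_le (y z : B) {s u w : ℝ} (hw : w ^ 2 = s ^ 2 + u ^ 2) :
    star (w⁻¹ • (s • y + u • z)) * (w⁻¹ • (s • y + u • z)) ≤ star y * y + star z * z := by
  rcases eq_or_ne w 0 with rfl | hw0
  · simp only [inv_zero, zero_smul, star_zero, zero_mul]
    exact add_nonneg (star_mul_self_nonneg _) (star_mul_self_nonneg _)
  · have h : star y * y + star z * z - star (w⁻¹ • (s • y + u • z)) * (w⁻¹ • (s • y + u • z))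
        = star (w⁻¹ • (u • y - s • z)) * (w⁻¹ • (u • y - s • z)) := by
      rw [sub_eq_iff_eq_add]
      have e : star (w⁻¹ • (u • y - s • z)) * (w⁻¹ • (u • y - s • z))
          + star (w⁻¹ • (s • y + u • z)) * (w⁻¹ • (s • y + u • z))
          = (w⁻¹ * w⁻¹ * (s ^ 2 + u ^ 2)) • (star y * y + star z * z) := by
        simp only [star_smul, star_add, star_sub, star_trivial, smul_mul_smul_comm, add_mul,
          mul_add, sub_mul, mul_sub, smul_add, smul_sub, smul_smul]
        module
      rw [e, ← hw, show w⁻¹ * w⁻¹ * w ^ 2 = 1 by field_simp, one_smul]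
    rw [← sub_nonneg, h]
    exact star_mul_self_nonneg _

/-- The cone used to dominate a functional `φ` by a positive one. -/
def dominationCone (φ : B →L[ℂ] ℂ) : PointedCone ℝ (B × ℝ) where
  carrier := {p | ∃ (y : B) (s c : ℝ), 0 ≤ c ∧ star y * y ≤ p.1 + star p.1 + algebraMap ℝ B c ∧
    c * ‖φ‖ ^ 2 + s ^ 2 - 2 * s * (φ y).re ≤ p.2}
  zero_mem' := ⟨0, 0, 0, le_rfl, by simp, by simp⟩
  add_mem' := by
    rintro ⟨q, r⟩ ⟨q', r'⟩ ⟨y, s, c, hc, h1, h2⟩ ⟨z, u, d, hd, h3, h4⟩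
    have hw : (√(s ^ 2 + u ^ 2)) ^ 2 = s ^ 2 + u ^ 2 := Real.sq_sqrt (by positivity)
    set w := √(s ^ 2 + u ^ 2)
    refine ⟨w⁻¹ • (s • y + u • z), w, c + d, add_nonneg hc hd, ?_, ?_⟩
    · refine (star_mul_self_combination_le y z hw).trans ((add_le_add h1 h3).trans_eq ?_)
      simp only [Prod.fst_add, star_add, map_add]
      abel
    · have e : 2 * w * (φ (w⁻¹ • (s • y + u • z))).re = 2 * (s * (φ y).re + u * (φ z).re) := by
        rcases eq_or_ne w 0 with hw0 | hw0
        · rw [hw0] at hw ⊢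
          have hs : s = 0 := by nlinarith
          have hu : u = 0 := by nlinarith
          simp [hs, hu]
        · rw [← Complex.coe_smul w⁻¹, ← Complex.coe_smul s, ← Complex.coe_smul u, map_smul,
            map_add, map_smul, map_smul]
          simp only [smul_eq_mul, Complex.re_ofReal_mul, Complex.add_re]
          field_simp
      rw [e]
      simp only [Prod.snd_add] at *
      nlinarith
  smul_mem' := by
    rintro ⟨a, ha⟩ ⟨q, r⟩ ⟨y, s, c, hc, h1, h2⟩
    have hw : √a * √a = a := Real.mul_self_sqrt ha
    refine ⟨√a • y, √a * s, a * c, mul_nonneg ha hc, ?_, ?_⟩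
    · have h := smul_le_smul_of_nonneg_left h1 ha
      rw [star_smul, star_trivial, smul_mul_smul_comm, hw]
      refine h.trans_eq ?_
      change _ = a • q + star (a • q) + _
      rw [smul_add, smul_add, star_smul, star_trivial a, map_mul, ← Algebra.smul_def]
    · rw [← Complex.coe_smul √a, map_smul]
      simp only [smul_eq_mul, Complex.re_ofReal_mul]
      have h := mul_le_mul_of_nonneg_left h2 ha
      refine le_trans (le_of_eq ?_) h
      linear_combination (s ^ 2 - 2 * s * (φ y).re) * hw

theorem exists_positive_dominating (φ : B →L[ℂ] ℂ) :
    ∃ ψ : B →ₚ[ℂ] ℂ, ∀ y, ‖φ y‖ ^ 2 ≤ (ψ (star y * y)).re := by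
  have hne : ((0 : B), (1 : ℝ)) ≠ 0 := by simp
  let f : B × ℝ →ₗ.[ℝ] ℝ := LinearPMap.mkSpanSingleton ((0 : B), (1 : ℝ)) (1 : ℝ) hne
  have nonneg : ∀ x : f.domain, (x : B × ℝ) ∈ dominationCone φ → 0 ≤ f x := by
    rintro ⟨p, hp⟩ ⟨y, s, c, hc, h1, h2⟩
    obtain ⟨r, rfl⟩ := Submodule.mem_span_singleton.1 hp
    rw [LinearPMap.mkSpanSingleton'_apply]
    simp at h1 h2 ⊢
    rw [← CStarAlgebra.norm_le_iff_le_algebraMap _ hc, CStarRing.norm_star_mul_self] at h1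
    have h3 : |(φ y).re| ≤ ‖φ‖ * ‖y‖ := (Complex.abs_re_le_norm _).trans (φ.le_opNorm y)
    have h4 : ‖y‖ * ‖y‖ * ‖φ‖ ^ 2 ≤ c * ‖φ‖ ^ 2 := by gcongr
    have h5 : s * (φ y).re ≤ |s| * (‖φ‖ * ‖y‖) := (le_abs_self _).trans (by rw [abs_mul]; gcongr)
    nlinarith [sq_nonneg (|s| - ‖φ‖ * ‖y‖), sq_abs s]
  have dense : ∀ p, ∃ x : f.domain, (x : B × ℝ) + p ∈ dominationCone φ := by
    rintro ⟨a, r⟩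
    refine ⟨⟨(‖a + star a‖ * ‖φ‖ ^ 2 - r) • (0, 1), Submodule.mem_span_singleton.2 ⟨_, rfl⟩⟩,
      0, 0, ‖a + star a‖, norm_nonneg _, ?_, by simp⟩
    have := IsSelfAdjoint.neg_algebraMap_norm_le_self (a := a + star a) (IsSelfAdjoint.add_star_self a)
    simpa [← sub_nonneg] using this
  obtain ⟨g, hg1, hg2⟩ := riesz_extension (dominationCone φ) f nonneg dense
  have hg : g (0, 1) = 1 := by
    rw [hg1 ⟨((0 : B), (1 : ℝ)), Submodule.mem_span_singleton_self _⟩,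
      LinearPMap.mkSpanSingleton_apply]
  let ψ₀ : B →ₗ[ℝ] ℝ := (1 / 2 : ℝ) • g.comp (LinearMap.inl ℝ B ℝ)
  have h1 : ∀ a : B, star a = a → ∀ y s, star y * y ≤ a →
      2 * s * (φ y).re - s ^ 2 ≤ ψ₀ a := by
    intro a ha y s hya
    have := hg2 ((1 / 2 : ℝ) • a, s ^ 2 - 2 * s * (φ y).re) ⟨y, s, 0, le_rfl, by
      refine hya.trans_eq ?_
      simp only [star_smul, star_trivial, ha, map_zero, add_zero]
      module, by simp⟩
    rw [show ((1 / 2 : ℝ) • a, s ^ 2 - 2 * s * (φ y).re)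
      = (1 / 2 : ℝ) • (a, (0 : ℝ)) + (s ^ 2 - 2 * s * (φ y).re) • ((0 : B), (1 : ℝ)) by
        ext <;> simp, map_add, map_smul, map_smul, hg] at this
    change _ ≤ (1 / 2 : ℝ) • g (a, 0)
    simp only [smul_eq_mul] at *
    linarith
  have h2 : ∀ a : B, star a = a → ψ₀ (Complex.I • a) = 0 := by
    intro a ha
    have hs : ∀ e : ℝ, 0 ≤ g (e • (Complex.I • a, (0 : ℝ))) := by
      intro e
      refine hg2 _ ⟨0, 0, 0, le_rfl, ?_, by simp⟩
      simp [ha]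
    have h3 := hs 1
    have h4 := hs (-1)
    rw [map_smul] at h3 h4
    change (1 / 2 : ℝ) • g (Complex.I • a, 0) = 0
    simp only [smul_eq_mul] at *
    linarith
  have hpos : ∀ a, 0 ≤ a → 0 ≤ Module.Dual.extendRCLike (𝕜 := ℂ) ψ₀ a := by
    intro a ha
    have ha' : star a = a := (IsSelfAdjoint.of_nonneg ha).star_eq
    have h3 := h1 a ha' 0 0 (by simpa using ha)
    rw [Module.Dual.extendRCLike_apply]
    have h4 := h2 a ha'
    rw [show (RCLike.I : ℂ) = Complex.I from rfl, h4]
    simp at h3 ⊢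
    exact h3
  refine ⟨PositiveLinearMap.mk₀ _ hpos, fun y => ?_⟩
  have hre : ∀ a, (PositiveLinearMap.mk₀ _ hpos a).re = ψ₀ a := fun a =>
    Module.Dual.re_extendRCLike_apply (𝕜 := ℂ) ψ₀ a
  rw [hre]
  obtain ⟨θ, hθ, hθ'⟩ : ∃ θ : ℂ, ‖θ‖ = 1 ∧ θ * φ y = ‖φ y‖ := by
    rcases eq_or_ne (φ y) 0 with h0 | h0
    · exact ⟨1, by simp, by simp [h0]⟩
    · have : (‖φ y‖ : ℂ) ≠ 0 := by exact_mod_cast norm_ne_zero_iff.2 h0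
      refine ⟨‖φ y‖ / φ y, ?_, div_mul_cancel₀ _ h0⟩
      rw [norm_div, Complex.norm_real, norm_norm, div_self (norm_ne_zero_iff.2 h0)]
  have e : star (θ • y) * (θ • y) = star y * y := by
    rw [star_smul, smul_mul_smul_comm]
    have : star θ * θ = 1 := by
      rw [Complex.star_def, Complex.conj_mul', hθ]; simp
    rw [this, one_smul]
  have h5 := h1 (star y * y) (by simp) (θ • y) ‖φ y‖ e.le
  rw [map_smul, smul_eq_mul, hθ', Complex.ofReal_re] at h5
  nlinarith

end Domination

section Representation

open scoped ComplexOrder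

variable {B : Type*} [CStarAlgebra B] [PartialOrder B] [StarOrderedRing B] {κ : Type*}

theorem exists_positive_dominating_finset (F : Finset κ) (φ : κ → B →L[ℂ] ℂ) :
    ∃ ψ : B →ₚ[ℂ] ℂ, ∀ k ∈ F, ∀ y, ‖φ k y‖ ^ 2 ≤ (ψ (star y * y)).re := by
  classical
  choose ψ hψ using fun k => exists_positive_dominating (φ k)
  have hnonneg : ∀ k y, 0 ≤ y → 0 ≤ ψ k y := fun k y hy => (ψ k).map_nonneg hy
  refine ⟨PositiveLinearMap.mk₀ (∑ k ∈ F, (ψ k).toLinearMap) fun y hy => ?_, fun k hk y => ?_⟩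
  · rw [LinearMap.sum_apply]
    exact Finset.sum_nonneg fun k _ => hnonneg k y hy
  · refine (hψ k y).trans ?_
    change _ ≤ ((∑ k ∈ F, (ψ k).toLinearMap) (star y * y)).re
    rw [LinearMap.sum_apply, Complex.re_sum]
    exact Finset.single_le_sum (f := fun k => (ψ k (star y * y)).re)
      (fun k _ => (Complex.nonneg_iff.1 (hnonneg k _ (star_mul_self_nonneg y))).1) hk

theorem exists_inner_gns (ψ : B →ₚ[ℂ] ℂ) (φ : B →L[ℂ] ℂ)
    (h : ∀ y, ‖φ y‖ ^ 2 ≤ (ψ (star y * y)).re) :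
    ∃ η : ψ.GNS, ∀ y, φ y = inner ℂ η (ψ.gnsStarAlgHom y (ψ.toPreGNS 1 : ψ.PreGNS)) := by
  let φ' : ψ.PreGNS →L[ℂ] ℂ := LinearMap.mkContinuous
    (φ.toLinearMap.comp ψ.ofPreGNS.toLinearMap) 1 fun a => by
      rw [one_mul, ← sq_le_sq₀ (norm_nonneg _) (norm_nonneg _)]
      refine (h (ψ.ofPreGNS a)).trans_eq ?_
      rw [← ψ.preGNS_norm_sq, ← Complex.ofReal_pow, Complex.ofReal_re]
  let φ'' : ψ.GNS →L[ℂ] ℂ := φ'.extend UniformSpace.Completion.toComplL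
  have hφ : ∀ a : ψ.PreGNS, φ'' a = φ' a := fun a =>
    φ'.extend_eq (e := UniformSpace.Completion.toComplL) UniformSpace.Completion.denseRange_coe
      (UniformSpace.Completion.isUniformInducing_coe _) a
  refine ⟨(InnerProductSpace.toDual ℂ ψ.GNS).symm φ'', fun y => ?_⟩
  rw [InnerProductSpace.toDual_symm_apply]
  have : ψ.gnsStarAlgHom y ((ψ.toPreGNS 1 : ψ.PreGNS) : ψ.GNS) = (ψ.toPreGNS y : ψ.PreGNS) := by
    simp
  rw [this, hφ]
  rfl

end Representation

section Approximation

variable {X : Type*} [NormedAddCommGroup X] [NormedSpace ℂ X]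
  {B : Type*} [CStarAlgebra B] {ι : X →ₗᵢ[ℂ] B} {t : X → X → X → X}

/-- Real combinations of the elements `a b* - b a*`. -/
noncomputable def leftInner (ι : X →ₗᵢ[ℂ] B) : Submodule ℝ B :=
  Submodule.span ℝ {s | ∃ a b : X, s = ι a * star (ι b) - ι b * star (ι a)}

/-- Real combinations of the elements `c* d - d* c`. -/
noncomputable def rightInner (ι : X →ₗᵢ[ℂ] B) : Submodule ℝ B :=
  Submodule.span ℝ {s | ∃ c d : X, s = star (ι c) * ι d - star (ι d) * ι c}

/-- The linear span of the elements `a b*`. -/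
noncomputable def leftAlgebra (ι : X →ₗᵢ[ℂ] B) : Submodule ℂ B :=
  Submodule.span ℂ {s | ∃ a b : X, s = ι a * star (ι b)}

/-- The linear span of the elements `c* d`. -/
noncomputable def rightAlgebra (ι : X →ₗᵢ[ℂ] B) : Submodule ℂ B :=
  Submodule.span ℂ {s | ∃ c d : X, s = star (ι c) * ι d}

theorem mul_mem_span_of_generators {S : Set B} (hS : ∀ a ∈ S, ∀ b ∈ S, a * b ∈ S) {a b : B}
    (ha : a ∈ Submodule.span ℂ S) (hb : b ∈ Submodule.span ℂ S) :
    a * b ∈ Submodule.span ℂ S := by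
  have h := Submodule.mul_mem_mul ha hb
  rw [Submodule.span_mul_span] at h
  refine Submodule.span_mono ?_ h
  rintro _ ⟨a, ha, b, hb, rfl⟩
  exact hS a ha b hb

theorem mul_mem_leftAlgebra (ht : ∀ x y z, ι (t x y z) = ι x * star (ι y) * ι z) {a b : B}
    (ha : a ∈ leftAlgebra ι) (hb : b ∈ leftAlgebra ι) : a * b ∈ leftAlgebra ι := by
  refine mul_mem_span_of_generators ?_ ha hb
  rintro _ ⟨a, b, rfl⟩ _ ⟨c, d, rfl⟩
  exact ⟨t a b c, d, by rw [ht, mul_assoc (ι a * star (ι b))]⟩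

theorem mul_mem_rightAlgebra (ht : ∀ x y z, ι (t x y z) = ι x * star (ι y) * ι z) {a b : B}
    (ha : a ∈ rightAlgebra ι) (hb : b ∈ rightAlgebra ι) : a * b ∈ rightAlgebra ι := by
  refine mul_mem_span_of_generators ?_ ha hb
  rintro _ ⟨a, b, rfl⟩ _ ⟨c, d, rfl⟩
  exact ⟨a, t b c d, by rw [ht]; simp only [mul_assoc]⟩

theorem I_smul_add_star_mem {S : Set B} {V : Submodule ℝ B}
    (hS : ∀ s ∈ S, ∀ c : ℂ, Complex.I • (c • s + star (c • s)) ∈ V) {s : B}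
    (hs : s ∈ Submodule.span ℂ S) : Complex.I • (s + star s) ∈ V := by
  suffices ∀ c : ℂ, Complex.I • (c • s + star (c • s)) ∈ V by simpa using this 1
  induction hs using Submodule.span_induction with
  | mem s hs => exact hS s hs
  | zero => simp
  | add x y _ _ hx hy =>
    intro c
    have := V.add_mem (hx c) (hy c)
    rwa [← smul_add, add_add_add_comm, ← star_add, ← smul_add] at this
  | smul d x _ hx => intro c; rw [smul_smul]; exact hx _

theorem I_smul_add_star_mem_leftInner {s : B} (hs : s ∈ leftAlgebra ι) :
    Complex.I • (s + star s) ∈ leftInner ι := by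
  refine I_smul_add_star_mem ?_ hs
  rintro _ ⟨a, b, rfl⟩ c
  refine Submodule.subset_span ⟨(Complex.I * c) • a, b, ?_⟩
  simp only [map_smul, star_smul, star_mul, star_star, smul_add, smul_smul, smul_mul_assoc,
    mul_smul_comm, Complex.star_def, Complex.conj_I, neg_smul, sub_neg_eq_add, mul_neg]
  rw [mul_comm Complex.I ((starRingEnd ℂ) c)]

theorem I_smul_add_star_mem_rightInner {s : B} (hs : s ∈ rightAlgebra ι) :
    Complex.I • (s + star s) ∈ rightInner ι := by
  refine I_smul_add_star_mem ?_ hs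
  rintro _ ⟨a, b, rfl⟩ c
  refine Submodule.subset_span ⟨a, (Complex.I * c) • b, ?_⟩
  simp only [map_smul, star_smul, star_mul, star_star, smul_add, smul_smul, smul_mul_assoc,
    mul_smul_comm, Complex.star_def, Complex.conj_I, neg_mul, neg_smul, sub_neg_eq_add, mul_neg]
  rw [mul_comm Complex.I ((starRingEnd ℂ) c)]

variable {G : Type*} [NormedAddCommGroup G] [InnerProductSpace ℂ G] [CompleteSpace G]
  {κ : Type*} (π : B →⋆ₐ[ℂ] (G →L[ℂ] G))

theorem exists_I_smul_eq_of_mem_map {𝒜 : Submodule ℂ B} {V : Submodule ℝ B}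
    (hV : ∀ s ∈ 𝒜, Complex.I • (s + star s) ∈ V) {T : G →L[ℂ] G}
    (hT : T ∈ 𝒜.map π.toAlgHom.toLinearMap) (hsa : IsSelfAdjoint T) :
    ∃ s ∈ V, π s = Complex.I • T := by
  obtain ⟨s, hs, rfl⟩ := hT
  refine ⟨(1 / 2 : ℝ) • Complex.I • (s + star s), V.smul_mem _ (hV s hs), ?_⟩
  have h : star (π s) = π s := hsa.star_eq
  change _ = Complex.I • π s
  rw [← Complex.coe_smul, map_smul, map_smul, map_add, map_star, h]
  rw [← two_smul ℂ, smul_comm Complex.I, smul_smul]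
  norm_num

theorem mul_mem_map {𝒜 : Submodule ℂ B} (h : ∀ a ∈ 𝒜, ∀ b ∈ 𝒜, a * b ∈ 𝒜) :
    ∀ a ∈ 𝒜.map π.toAlgHom.toLinearMap, ∀ b ∈ 𝒜.map π.toAlgHom.toLinearMap,
      a * b ∈ 𝒜.map π.toAlgHom.toLinearMap := by
  rintro _ ⟨a, ha, rfl⟩ _ ⟨b, hb, rfl⟩
  exact ⟨a * b, h a ha b hb, map_mul π a b⟩

variable (F : Finset κ) (x : κ → X) (η : κ → G) (ξ : G)

theorem re_sum_inner_left_eq_zero (ht : ∀ x y z, ι (t x y z) = ι x * star (ι y) * ι z)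
    (hα : ∀ α ∈ leftInner ι, (∑ k ∈ F, inner ℂ (η k) (π (α * ι (x k)) ξ)).re = 0)
    (δ : X →L[ℂ] X) (i : ℤ) :
    (∑ k ∈ F, inner ℂ (η k) ((Complex.I • (essentialRange
      (leftOperators δ (fun x => π (ι x)) i)).starProjection * π (ι (x k))) ξ)).re = 0 := by
  have h := re_sum_inner_starProjection_eq_zero F (fun k => (-Complex.I) • η k)
    (fun k => π (ι (x k)) ξ) (leftOperators δ (fun x => π (ι x)) i)
    ((leftAlgebra ι).map π.toAlgHom.toLinearMap)
    (mul_mem_map π fun a ha b hb => mul_mem_leftAlgebra ht ha hb) ?_ ?_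
  · simpa [inner_smul_left, inner_smul_right] using h
  · rintro _ ⟨a, _, rfl⟩
    refine ⟨ι a * star (ι a), Submodule.subset_span ⟨a, a, rfl⟩, ?_⟩
    change π _ = _
    rw [map_mul, map_star]
  · intro T hT hsa
    obtain ⟨s, hs, hsT⟩ :=
      exists_I_smul_eq_of_mem_map π (fun s => I_smul_add_star_mem_leftInner) hT hsa
    have := hα s hs
    simpa [hsT, inner_smul_left, inner_smul_right] using this

theorem re_sum_inner_right_eq_zero (ht : ∀ x y z, ι (t x y z) = ι x * star (ι y) * ι z)
    (hβ : ∀ β ∈ rightInner ι, (∑ k ∈ F, inner ℂ (η k) (π (ι (x k) * β) ξ)).re = 0)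
    (δ : X →L[ℂ] X) (i : ℤ) :
    (∑ k ∈ F, inner ℂ (η k) ((Complex.I • (π (ι (x k)) * (essentialRange
      (rightOperators δ (fun x => π (ι x)) i)).starProjection)) ξ)).re = 0 := by
  have h := re_sum_inner_starProjection_eq_zero F
    (fun k => star (π (ι (x k))) ((-Complex.I) • η k))
    (fun k => ξ) (rightOperators δ (fun x => π (ι x)) i)
    ((rightAlgebra ι).map π.toAlgHom.toLinearMap)
    (mul_mem_map π fun a ha b hb => mul_mem_rightAlgebra ht ha hb) ?_ ?_
  · simpa only [star_eq_adjoint, adjoint_inner_left, inner_smul_left, inner_smul_right,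
      smul_apply, mul_apply_eq_comp, map_neg, Complex.conj_I, neg_neg] using h
  · rintro _ ⟨u, a, b, _, _, rfl⟩
    refine ⟨star (ι a) * ι (t b b a), Submodule.subset_span ⟨a, t b b a, rfl⟩, ?_⟩
    change π _ = _
    rw [ht]
    simp only [map_mul, map_star, star_mul, star_star, mul_assoc]
  · intro T hT hsa
    obtain ⟨s, hs, hsT⟩ :=
      exists_I_smul_eq_of_mem_map π (fun s => I_smul_add_star_mem_rightInner) hT hsa
    have := hβ s hs
    simpa only [star_eq_adjoint, adjoint_inner_left, inner_smul_left, inner_smul_right,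
      smul_apply, mul_apply_eq_comp, map_neg, Complex.conj_I, neg_neg, map_mul, hsT,
      map_smul] using this

end Approximation

section Core

variable {X : Type*} [NormedAddCommGroup X] [NormedSpace ℂ X] [CompleteSpace X]
  {B : Type*} [CStarAlgebra B] {ι : X →ₗᵢ[ℂ] B} {t : X → X → X → X}

theorem re_sum_derivation_eq_zero
    (ht : ∀ x y z, ι (t x y z) = ι x * star (ι y) * ι z) {D : X →L[ℂ] X}
    (hD : ∀ x y z, ι (D (t x y z)) = ι (D x) * star (ι y) * ι z + ι x * star (ι (D y)) * ι z
      + ι x * star (ι y) * ι (D z))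
    {G : Type*} [NormedAddCommGroup G] [InnerProductSpace ℂ G] [CompleteSpace G]
    (π : B →⋆ₐ[ℂ] (G →L[ℂ] G)) {κ : Type*} (F : Finset κ) (x : κ → X) (η : κ → G) (ξ : G)
    (hα : ∀ α ∈ leftInner ι, (∑ k ∈ F, inner ℂ (η k) (π (α * ι (x k)) ξ)).re = 0)
    (hβ : ∀ β ∈ rightInner ι, (∑ k ∈ F, inner ℂ (η k) (π (ι (x k) * β) ξ)).re = 0) :
    (∑ k ∈ F, inner ℂ (η k) (π (ι (D (x k))) ξ)).re = 0 := by
  set v := (∑ k ∈ F, inner ℂ (η k) (π (ι (D (x k))) ξ)).re with hv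
  set C := ∑ k ∈ F, ‖η k‖ * (Real.exp 6 * ‖x k‖ * ‖ξ‖) with hC
  have key : ∀ n : ℕ, n * |v| ≤ C := by
    intro n
    let δ : X →L[ℂ] X := (-(n : ℂ) * Complex.I) • D
    have hδx : ∀ y, ι (δ y) = (-(n : ℂ) * Complex.I) • ι (D y) := fun y => map_smul ι _ _
    have hδ : ∀ x y z, ι (δ (t x y z)) = ι (δ x) * star (ι y) * ι z
        - ι x * star (ι (δ y)) * ι z + ι x * star (ι y) * ι (δ z) := by
      intro x y z
      simp only [hδx, hD, star_smul, smul_mul_assoc, mul_smul_comm, smul_add]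
      have : star (-(n : ℂ) * Complex.I) = -(-(n : ℂ) * Complex.I) := by simp
      rw [this, neg_smul, sub_neg_eq_add]
    obtain ⟨N, l, hl⟩ := exists_filtration_estimate ht hδ π
    set h : G →L[ℂ] G := ∑ i ∈ Finset.range N,
      (essentialRange (leftOperators δ (fun x => π (ι x)) (l i))).starProjection
    set k : G →L[ℂ] G := ∑ i ∈ Finset.range N,
      (essentialRange (rightOperators δ (fun x => π (ι x)) (l i))).starProjection
    have h1 : (∑ j ∈ F, inner ℂ (η j) ((Complex.I • (h * π (ι (x j)))) ξ)).re = 0 := by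
      simp only [h, Finset.sum_mul, Finset.smul_sum, sum_apply, inner_sum]
      rw [Finset.sum_comm, Complex.re_sum]
      exact Finset.sum_eq_zero fun i _ => re_sum_inner_left_eq_zero π F x η ξ ht hα δ (l i)
    have h2 : (∑ j ∈ F, inner ℂ (η j) ((Complex.I • (π (ι (x j)) * k)) ξ)).re = 0 := by
      simp only [k, Finset.mul_sum, Finset.smul_sum, sum_apply, inner_sum]
      rw [Finset.sum_comm, Complex.re_sum]
      exact Finset.sum_eq_zero fun i _ => re_sum_inner_right_eq_zero π F x η ξ ht hβ δ (l i)
    have h3 : (∑ j ∈ F, inner ℂ (η j) ((Complex.I • (π (ι (δ (x j)))) : G →L[ℂ] G) ξ)).re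
        = n * v := by
      rw [hv, ← Complex.re_ofReal_mul, Finset.mul_sum]
      congr 1
      refine Finset.sum_congr rfl fun j _ => ?_
      rw [hδx, map_smul, smul_smul, smul_apply, inner_smul_right]
      congr 1
      push_cast
      linear_combination (-(n : ℂ)) * Complex.I_mul_I
    have h4 : n * v = (∑ j ∈ F, inner ℂ (η j) ((Complex.I • (π (ι (δ (x j)))
        - (h * π (ι (x j)) - π (ι (x j)) * k)) : G →L[ℂ] G) ξ)).re := by
      simp only [smul_sub, sub_apply, inner_sub_right, Finset.sum_sub_distrib, Complex.sub_re,
        h1, h2, h3, sub_zero]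
    calc n * |v| = |n * v| := by rw [abs_mul, Nat.abs_cast]
      _ ≤ ‖∑ j ∈ F, inner ℂ (η j) ((Complex.I • (π (ι (δ (x j)))
        - (h * π (ι (x j)) - π (ι (x j)) * k)) : G →L[ℂ] G) ξ)‖ := by
          rw [h4]; exact Complex.abs_re_le_norm _
      _ ≤ C := by
        refine norm_sum_le_of_le _ fun j _ => (norm_inner_le_norm _ _).trans ?_
        gcongr
        refine (le_opNorm _ _).trans ?_
        rw [norm_smul, Complex.norm_I, one_mul]
        gcongr
        exact hl (x j)
  by_contra hne
  obtain ⟨n, hn⟩ := exists_nat_gt (C / |v|)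
  rw [div_lt_iff₀ (abs_pos.2 hne)] at hn
  exact (key n).not_gt hn

open scoped ComplexOrder

variable [PartialOrder B] [StarOrderedRing B]

/-- A ternary derivation is a point-norm limit of inner ones. -/
theorem exists_inner_approximation
    (ht : ∀ x y z, ι (t x y z) = ι x * star (ι y) * ι z) {D : X →L[ℂ] X}
    (hD : ∀ x y z, ι (D (t x y z)) = ι (D x) * star (ι y) * ι z + ι x * star (ι (D y)) * ι z
      + ι x * star (ι y) * ι (D z)) (F : Finset X) {ε : ℝ} (hε : 0 < ε) :
    ∃ α ∈ leftInner ι, ∃ β ∈ rightInner ι,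
      ∀ x ∈ F, ‖ι (D x) - (α * ι x + ι x * β)‖ < ε := by
  classical
  let L : B × B →ₗ[ℝ] (F → B) :=
    { toFun := fun p x => p.1 * ι x + ι x * p.2
      map_add' := fun p q => by
        ext x; simp only [Prod.fst_add, Prod.snd_add, add_mul, mul_add, Pi.add_apply]; abel
      map_smul' := fun c p => by ext x; simp }
  let V : Submodule ℝ (F → B) := ((leftInner ι).prod (rightInner ι)).map L
  let v : F → B := fun x => ι (D x)
  suffices hmem : v ∈ closure (V : Set (F → B)) by
    obtain ⟨w, hw, hvw⟩ := Metric.mem_closure_iff.1 hmem ε hε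
    obtain ⟨⟨α, β⟩, ⟨hα, hβ⟩, rfl⟩ := hw
    refine ⟨α, hα, β, hβ, fun x hx => ?_⟩
    have := (dist_pi_lt_iff hε).1 hvw ⟨x, hx⟩
    rwa [dist_eq_norm] at this
  by_contra hmem
  obtain ⟨f, u, hfu, huf⟩ := geometric_hahn_banach_point_closed
    (V.convex.closure) isClosed_closure hmem
  have hf0 : ∀ w ∈ V, f w = 0 := by
    intro w hw
    by_contra hne
    have h1 := huf _ (subset_closure (V.smul_mem ((u / f w)) hw))
    rw [map_smul, smul_eq_mul, div_mul_cancel₀ _ hne] at h1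
    exact lt_irrefl _ h1
  let φ : F → B →L[ℂ] ℂ := fun k =>
    StrongDual.extendRCLike (𝕜 := ℂ) (f.comp (ContinuousLinearMap.single ℝ (fun _ : F => B) k))
  have hφ : ∀ w : F → B, f w = (∑ k, φ k (w k)).re := by
    intro w
    rw [Complex.re_sum]
    have : ∀ k, (φ k (w k)).re = f (Pi.single k (w k)) := fun k =>
      Module.Dual.re_extendRCLike_apply (𝕜 := ℂ) _ (w k)
    simp_rw [this]
    rw [← map_sum, Finset.univ_sum_single]
  obtain ⟨ψ, hψ⟩ := exists_positive_dominating_finset Finset.univ φ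
  choose η hη using fun k => exists_inner_gns ψ (φ k) (hψ k (Finset.mem_univ k))
  have hv : f v = 0 := by
    rw [hφ]
    simp_rw [hη]
    refine re_sum_derivation_eq_zero ht hD ψ.gnsStarAlgHom Finset.univ (fun k : F => (k : X)) η _
      ?_ ?_
    · intro α hα
      have := hf0 (L (α, 0)) ⟨(α, 0), ⟨hα, zero_mem _⟩, rfl⟩
      rw [hφ] at this
      simp_rw [hη] at this
      simpa [L] using this
    · intro β hβ
      have := hf0 (L (0, β)) ⟨(0, β), ⟨zero_mem _, hβ⟩, rfl⟩
      rw [hφ] at this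
      simp_rw [hη] at this
      simpa [L] using this
  have h0 := huf 0 (subset_closure V.zero_mem)
  rw [map_zero] at h0
  linarith

end Core

end

section Concrete

variable {H K E : Type*}
  [NormedAddCommGroup H] [InnerProductSpace ℂ H] [CompleteSpace H]
  [NormedAddCommGroup K] [InnerProductSpace ℂ K] [CompleteSpace K]
  [NormedAddCommGroup E] [InnerProductSpace ℂ E] [CompleteSpace E]

theorem adjoint_apply_self_of_linearIsometry (U : H →ₗᵢ[ℂ] E) (x : H) :
    adjoint U.toContinuousLinearMap (U x) = x := by
  refine ext_inner_left ℂ fun y => ?_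
  rw [adjoint_inner_right]
  exact U.inner_map_map y x

theorem norm_conjugate_le (U : H →ₗᵢ[ℂ] E) (W : K →ₗᵢ[ℂ] E) (T : E →L[ℂ] E) :
    ‖adjoint U.toContinuousLinearMap ∘L T ∘L W.toContinuousLinearMap‖ ≤ ‖T‖ := by
  refine opNorm_le_bound _ (norm_nonneg _) fun x => ?_
  calc ‖adjoint U.toContinuousLinearMap (T (W x))‖
      ≤ 1 * ‖T (W x)‖ := by
        refine (le_opNorm _ _).trans ?_
        gcongr
        rw [LinearIsometryEquiv.norm_map]
        exact U.norm_toContinuousLinearMap_le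
    _ ≤ ‖T‖ * ‖x‖ := by
        rw [one_mul, ← W.norm_map x]
        exact le_opNorm _ _

/-- Operators between two subspaces, regarded as operators on the ambient space. -/
noncomputable def cornerEmbedding (U : H →ₗᵢ[ℂ] E) (W : K →ₗᵢ[ℂ] E) :
    (K →L[ℂ] H) →ₗᵢ[ℂ] (E →L[ℂ] E) where
  toFun x := U.toContinuousLinearMap ∘L x ∘L adjoint W.toContinuousLinearMap
  map_add' x y := by ext; simp
  map_smul' c x := by ext; simp
  norm_map' x := by
    refine le_antisymm (opNorm_le_bound _ (norm_nonneg _) fun ξ => ?_) ?_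
    · change ‖U (x (adjoint W.toContinuousLinearMap ξ))‖ ≤ _
      rw [U.norm_map]
      refine (le_opNorm _ _).trans ?_
      gcongr
      refine (le_opNorm _ _).trans (mul_le_of_le_one_left (norm_nonneg _) ?_)
      rw [LinearIsometryEquiv.norm_map]
      exact W.norm_toContinuousLinearMap_le
    · refine le_trans (le_of_eq ?_) (norm_conjugate_le U W _)
      congr 1
      ext ξ
      change x ξ = adjoint U.toContinuousLinearMap
        (U (x (adjoint W.toContinuousLinearMap (W ξ))))
      rw [adjoint_apply_self_of_linearIsometry, adjoint_apply_self_of_linearIsometry]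

variable (U : H →ₗᵢ[ℂ] E) (W : K →ₗᵢ[ℂ] E)

theorem cornerEmbedding_apply (x : K →L[ℂ] H) (ξ : E) :
    cornerEmbedding U W x ξ = U (x (adjoint W.toContinuousLinearMap ξ)) := rfl

theorem star_cornerEmbedding_apply (x : K →L[ℂ] H) (ξ : E) :
    star (cornerEmbedding U W x) ξ = W (adjoint x (adjoint U.toContinuousLinearMap ξ)) := by
  change adjoint (U.toContinuousLinearMap ∘L x ∘L adjoint W.toContinuousLinearMap) ξ = _
  rw [adjoint_comp, adjoint_comp, adjoint_adjoint]
  rfl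

theorem cornerEmbedding_ternary (x y z : K →L[ℂ] H) :
    cornerEmbedding U W (x ∘L adjoint y ∘L z)
      = cornerEmbedding U W x * star (cornerEmbedding U W y) * cornerEmbedding U W z := by
  ext ξ
  simp only [mul_apply_eq_comp, cornerEmbedding_apply, star_cornerEmbedding_apply,
    adjoint_apply_self_of_linearIsometry, comp_apply]

theorem exists_finset_sum_of_mem_span {M X : Type*} [AddCommGroup M] [Module ℝ M]
    [AddCommGroup X] [Module ℝ X] (g : X → X → M) (hg : ∀ (r : ℝ) a b, r • g a b = g (r • a) b)
    {m : M} (hm : m ∈ Submodule.span ℝ {s | ∃ a b, s = g a b}) :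
    ∃ (n : ℕ) (a b : Fin n → X), m = ∑ i, g (a i) (b i) := by
  obtain ⟨n, f, s, rfl⟩ := Submodule.mem_span_set'.1 hm
  choose a b hab using fun i => (s i).2
  exact ⟨n, fun i => f i • a i, b, Finset.sum_congr rfl fun i _ => by rw [hab, hg]⟩

theorem exists_sum_of_mem_leftInner {X B : Type*} [NormedAddCommGroup X] [NormedSpace ℂ X]
    [CStarAlgebra B] {ι : X →ₗᵢ[ℂ] B} {α : B} (hα : α ∈ leftInner ι) :
    ∃ (n : ℕ) (a b : Fin n → X), α = ∑ i, (ι (a i) * star (ι (b i)) - ι (b i) * star (ι (a i))) :=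
  exists_finset_sum_of_mem_span (fun a b => ι a * star (ι b) - ι b * star (ι a))
    (fun r a b => by
      simp only [← Complex.coe_smul, map_smul, star_smul, smul_sub, smul_mul_assoc, mul_smul_comm,
        Complex.star_def, Complex.conj_ofReal]) hα

theorem exists_sum_of_mem_rightInner {X B : Type*} [NormedAddCommGroup X] [NormedSpace ℂ X]
    [CStarAlgebra B] {ι : X →ₗᵢ[ℂ] B} {β : B} (hβ : β ∈ rightInner ι) :
    ∃ (n : ℕ) (c d : Fin n → X), β = ∑ i, (star (ι (c i)) * ι (d i) - star (ι (d i)) * ι (c i)) :=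
  exists_finset_sum_of_mem_span (fun c d => star (ι c) * ι d - star (ι d) * ι c)
    (fun r a b => by
      simp only [← Complex.coe_smul, map_smul, star_smul, smul_sub, smul_mul_assoc, mul_smul_comm,
        Complex.star_def, Complex.conj_ofReal]) hβ

/-- The first summand of a Hilbert sum. -/
noncomputable def sumInl : H →ₗᵢ[ℂ] WithLp 2 (H × K) where
  toFun x := WithLp.toLp 2 (x, 0)
  map_add' x y := by simp [← WithLp.toLp_add]
  map_smul' c x := by simp [← WithLp.toLp_smul]
  norm_map' x := by simp

/-- The second summand of a Hilbert sum. -/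
noncomputable def sumInr : K →ₗᵢ[ℂ] WithLp 2 (H × K) where
  toFun x := WithLp.toLp 2 (0, x)
  map_add' x y := by simp [← WithLp.toLp_add]
  map_smul' c x := by simp [← WithLp.toLp_smul]
  norm_map' x := by simp

end Concrete

/-- Every TRO-derivation `D` of a TRO `X ⊆ B(K,H)` is a strong operator limit of
inner TRO-derivations: for every `ε > 0` and every finite `F ⊆ X` there is an inner
TRO-derivation `D'` (given by `x ↦ α x + x β` with `α = Σ (aᵢbᵢ* - bᵢaᵢ*)`,
`β = Σ (cⱼ*dⱼ - dⱼ*cⱼ)`, entries from `X`) with `‖D x - D' x‖ < ε` for all `x ∈ F`. -/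
theorem stmt_11 {H K : Type*}
    [NormedAddCommGroup H] [InnerProductSpace ℂ H] [CompleteSpace H]
    [NormedAddCommGroup K] [InnerProductSpace ℂ K] [CompleteSpace K]
    (X : Submodule ℂ (K →L[ℂ] H)) (hXclosed : IsClosed (X : Set (K →L[ℂ] H)))
    (hXtro : ∀ x ∈ X, ∀ y ∈ X, ∀ z ∈ X, x ∘L (adjoint y) ∘L z ∈ X)
    (D : X →L[ℂ] X)
    (hder : ∀ x y z w : X,
      (w : K →L[ℂ] H) = (x : K →L[ℂ] H) ∘L adjoint (y : K →L[ℂ] H) ∘L (z : K →L[ℂ] H) →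
      (D w : K →L[ℂ] H) =
        (D x : K →L[ℂ] H) ∘L adjoint (y : K →L[ℂ] H) ∘L (z : K →L[ℂ] H)
          + (x : K →L[ℂ] H) ∘L adjoint (D y : K →L[ℂ] H) ∘L (z : K →L[ℂ] H)
          + (x : K →L[ℂ] H) ∘L adjoint (y : K →L[ℂ] H) ∘L (D z : K →L[ℂ] H)) :
    ∀ ε > (0 : ℝ), ∀ F : Finset X,
      ∃ (n m : ℕ) (a b : Fin n → X) (c d : Fin m → X),
        ∀ x ∈ F, ‖(D x : K →L[ℂ] H) -
          ((∑ i, ((a i : K →L[ℂ] H) ∘L adjoint (b i : K →L[ℂ] H)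
              - (b i : K →L[ℂ] H) ∘L adjoint (a i : K →L[ℂ] H))) ∘L (x : K →L[ℂ] H)
            + (x : K →L[ℂ] H) ∘L
              (∑ j, (adjoint (c j : K →L[ℂ] H) ∘L (d j : K →L[ℂ] H)
                - adjoint (d j : K →L[ℂ] H) ∘L (c j : K →L[ℂ] H))))‖ < ε := by
  intro ε hε F
  have : CompleteSpace X := hXclosed.completeSpace_coe
  let U : H →ₗᵢ[ℂ] WithLp 2 (H × K) := sumInl
  let W : K →ₗᵢ[ℂ] WithLp 2 (H × K) := sumInr
  let ι : X →ₗᵢ[ℂ] (WithLp 2 (H × K) →L[ℂ] WithLp 2 (H × K)) :=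
    (cornerEmbedding U W).comp X.subtypeₗᵢ
  let t : X → X → X → X := fun x y z => ⟨_, hXtro x x.2 y y.2 z z.2⟩
  have ht : ∀ x y z, ι (t x y z) = ι x * star (ι y) * ι z := fun x y z =>
    cornerEmbedding_ternary U W x y z
  have hD : ∀ x y z, ι (D (t x y z)) = ι (D x) * star (ι y) * ι z + ι x * star (ι (D y)) * ι z
      + ι x * star (ι y) * ι (D z) := fun x y z => by
    change cornerEmbedding U W (D (t x y z)) = _
    rw [hder x y z (t x y z) rfl, map_add, map_add, cornerEmbedding_ternary,
      cornerEmbedding_ternary, cornerEmbedding_ternary]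
    rfl
  obtain ⟨α, hα, β, hβ, h⟩ := exists_inner_approximation ht hD F hε
  obtain ⟨n, a, b, rfl⟩ := exists_sum_of_mem_leftInner hα
  obtain ⟨m, c, d, rfl⟩ := exists_sum_of_mem_rightInner hβ
  refine ⟨n, m, a, b, c, d, fun x hx => lt_of_le_of_lt ?_ (h x hx)⟩
  refine le_trans (le_of_eq (congrArg norm ?_)) (norm_conjugate_le U W _)
  have hι : ∀ (y : X) (ξ : WithLp 2 (H × K)),
      ι y ξ = U ((y : K →L[ℂ] H) (adjoint W.toContinuousLinearMap ξ)) := fun y ξ => rfl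
  have hι' : ∀ (y : X) (ξ : WithLp 2 (H × K)), star (ι y) ξ
      = W (adjoint (y : K →L[ℂ] H) (adjoint U.toContinuousLinearMap ξ)) := fun y ξ =>
    star_cornerEmbedding_apply U W y ξ
  ext ξ
  simp only [comp_apply, sub_apply, add_apply, sum_apply, mul_apply_eq_comp, map_sub, map_add,
    map_sum, LinearIsometry.coe_toContinuousLinearMap, hι, hι',
    adjoint_apply_self_of_linearIsometry]
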